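/- arXiv:0903.0369 — 3 statements merged into one kernel-verified Lean document; each statement's English description precedes it below -/
import Mathlib

section
/- Under Setting (G), there exists a configuration T = (t_i)_{i∈ℤ/nℤ} of real numbers such that: (A) the sets Γ_i^{<t_i}, i ∈ ℤ/nℤ, are pairwise disjoint; and (B) for every i ∈ ℤ/nℤ there exists i' ∉ {i−1, i} with Γ_i^{≤t_i} ∩ Γ_{i'}^{≤t_{i'}} ≠ ∅. (Proposition 5.1.) -/
open Set Filter Metric Topology

noncomputable section

/-- The open unit disk in the complex plane. -/
abbrev Disk : Set ℂ := Metric.ball 0 1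

/-- `x` lies on the open arc of the unit circle traversed counterclockwise
from `p` to `q`. -/
def InCcwArc (p q x : ℂ) : Prop :=
  ∃ a b c : ℝ, a < b ∧ b < c ∧ c < a + 2 * Real.pi ∧
    p = Complex.exp (a * Complex.I) ∧ x = Complex.exp (b * Complex.I) ∧
    q = Complex.exp (c * Complex.I)

/-- Setting (G). -/
structure SettingG (n : ℕ) (Γ : ZMod n → ℝ → ↥Disk) (α ω : ZMod n → ℂ) : Prop where
  hn : 3 ≤ n
  cont : ∀ i, Continuous (Γ i)
  injIcc : ∀ i, ∀ k : ℤ, Set.InjOn (Γ i) (Set.Icc (k : ℝ) (k + 1))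
  limBot : ∀ i, Filter.Tendsto (fun t : ℝ => (Γ i t).1) Filter.atBot (nhds (α i))
  limTop : ∀ i, Filter.Tendsto (fun t : ℝ => (Γ i t).1) Filter.atTop (nhds (ω i))
  αmem : ∀ i, α i ∈ Metric.sphere (0:ℂ) 1
  ωmem : ∀ i, ω i ∈ Metric.sphere (0:ℂ) 1
  αinj : Function.Injective α
  ωinj : Function.Injective ω
  αω : ∀ i j, α i ≠ ω j
  arcMem : ∀ i, InCcwArc (ω (i - 1)) (ω i) (α (i + 1))
  arcOnlyα : ∀ i j, InCcwArc (ω (i - 1)) (ω i) (α j) → j = i + 1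
  arcNoω : ∀ i j, ¬ InCcwArc (ω (i - 1)) (ω i) (ω j)
  noTriplePt : ∀ i, ∀ t₁ t₂ t₃ : ℝ, Γ i t₁ = Γ i t₂ → Γ i t₁ = Γ i t₃ →
    t₁ = t₂ ∨ t₁ = t₃ ∨ t₂ = t₃
  finInter : ∀ i i', i ≠ i' → (Set.range (Γ i) ∩ Set.range (Γ i')).Finite
  noDouble : ∀ i i', i ≠ i' → ∀ x ∈ Set.range (Γ i) ∩ Set.range (Γ i'),
    ∀ t t' : ℝ, Γ i t = x → Γ i t' = x → t = t'
  noTripleCurve : ∀ i i' i'', i ≠ i' → i ≠ i'' → i' ≠ i'' →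
    Set.range (Γ i) ∩ Set.range (Γ i') ∩ Set.range (Γ i'') = ∅

/-- Condition (A): the sets `Γᵢ((-∞, tᵢ))` are pairwise disjoint. -/
def CondA (n : ℕ) (Γ : ZMod n → ℝ → ↥Disk) (t : ZMod n → ℝ) : Prop :=
  Pairwise fun i j => Disjoint (Γ i '' Set.Iio (t i)) (Γ j '' Set.Iio (t j))

/-- The set `Σ(T)`. -/
def SigmaSet (n : ℕ) (Γ : ZMod n → ℝ → ↥Disk) (t : ZMod n → ℝ) : Set (ZMod n) :=
  {i | ∃ i', i' ≠ i - 1 ∧ i' ≠ i ∧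
    ((Γ i '' Set.Iic (t i)) ∩ (Γ i' '' Set.Iic (t i'))).Nonempty}


lemma hp_compactify (γ : ℝ → ℂ) (hc : Continuous γ) (p q : ℂ)
    (hp : Tendsto γ atBot (𝓝 p)) (hq : Tendsto γ atTop (𝓝 q)) :
    ∃ g : ℝ → ℂ, Continuous g ∧ g (-(Real.pi/2)) = p ∧ g (Real.pi/2) = q ∧
      ∀ t, g t = p ∨ g t = q ∨ ∃ s, g t = γ s := by
  have hlt : -(Real.pi/2) < Real.pi/2 := by linarith [Real.pi_pos]
  have hcon : ContinuousOn (fun t => γ (Real.tan t)) (Ioo (-(Real.pi/2)) (Real.pi/2)) :=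
    hc.comp_continuousOn Real.continuousOn_tan_Ioo
  have h1 : Tendsto (fun t => γ (Real.tan t)) (𝓝[>] (-(Real.pi/2))) (𝓝 p) :=
    hp.comp Real.tendsto_tan_neg_pi_div_two
  have h2 : Tendsto (fun t => γ (Real.tan t)) (𝓝[<] (Real.pi/2)) (𝓝 q) :=
    hq.comp Real.tendsto_tan_pi_div_two
  have hE := continuousOn_Icc_extendFrom_Ioo hcon h1 h2
  have e1 := eq_lim_at_left_extendFrom_Ioo hlt h1
  have e2 := eq_lim_at_right_extendFrom_Ioo hlt h2
  set F := extendFrom (Ioo (-(Real.pi/2)) (Real.pi/2)) (fun t => γ (Real.tan t)) with hF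
  have e3 : ∀ t ∈ Ioo (-(Real.pi/2)) (Real.pi/2), F t = γ (Real.tan t) := by
    intro t ht
    exact extendFrom_extends hcon t ht
  refine ⟨IccExtend hlt.le ((Icc (-(Real.pi/2)) (Real.pi/2)).domRestrict F), ?_, ?_, ?_, ?_⟩
  · exact (continuousOn_iff_continuous_domRestrict.1 hE).Icc_extend'
  · rw [IccExtend_left]; exact e1
  · rw [IccExtend_right]; exact e2
  · intro t
    have hm := (projIcc (-(Real.pi/2)) (Real.pi/2) hlt.le t).2
    show F (projIcc (-(Real.pi/2)) (Real.pi/2) hlt.le t) = p ∨ _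
    show _ ∨ F (projIcc (-(Real.pi/2)) (Real.pi/2) hlt.le t) = q ∨ ∃ s, F (projIcc (-(Real.pi/2)) (Real.pi/2) hlt.le t) = γ s
    generalize ((projIcc (-(Real.pi/2)) (Real.pi/2) hlt.le t : Icc (-(Real.pi/2)) (Real.pi/2)) : ℝ) = v at hm
    rcases eq_or_lt_of_le hm.1 with h | h
    · left; rw [← h]; exact e1
    rcases eq_or_lt_of_le hm.2 with h' | h'
    · right; left; rw [h']; exact e2
    · right; right; exact ⟨_, e3 v ⟨h, h'⟩⟩

lemma hp_lift (h : ℝ × ℝ → ℂ) (hc : Continuous h) (h0 : ∀ x, h x ≠ 0) :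
    ∃ g : ℝ × ℝ → ℂ, Continuous g ∧ ∀ x, Complex.exp (g x) = h x := by
  obtain ⟨F, ⟨-, hF⟩, -⟩ := Complex.isCoveringMap_exp.existsUnique_continuousMap_lifts
    (A := ℝ × ℝ) ⟨fun x => ⟨h x, h0 x⟩, by fun_prop⟩ (0,0) (Complex.log (h (0,0)))
    (Subtype.ext (Complex.exp_log (h0 _)))
  refine ⟨F, F.continuous, fun x => ?_⟩
  have := congrFun hF x
  exact congrArg Subtype.val this

lemma hp_arg (θ : ℝ) (h0 : 0 < θ) (h1 : θ < 2 * Real.pi) :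
    (Complex.log (1 - Complex.exp (θ * Complex.I))).im = (θ - Real.pi)/2 := by
  have key : 1 - Complex.exp (θ * Complex.I) =
      ((2 * Real.sin (θ/2) : ℝ) : ℂ) * (Real.cos ((θ - Real.pi)/2) + Real.sin ((θ - Real.pi)/2) * Complex.I) := by
    have c1 : Real.cos ((θ - Real.pi)/2) = Real.sin (θ/2) := by
      rw [show (θ - Real.pi)/2 = θ/2 - Real.pi/2 by ring, Real.cos_sub_pi_div_two]
    have c2 : Real.sin ((θ - Real.pi)/2) = -Real.cos (θ/2) := by
      rw [show (θ - Real.pi)/2 = θ/2 - Real.pi/2 by ring, Real.sin_sub_pi_div_two]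
    have c3 : Real.cos θ = 1 - 2 * Real.sin (θ/2)^2 := by
      have := Real.cos_two_mul (θ/2)
      have h2 := Real.sin_sq_add_cos_sq (θ/2)
      rw [show 2 * (θ/2) = θ by ring] at this
      linarith
    have c4 : Real.sin θ = 2 * Real.sin (θ/2) * Real.cos (θ/2) := by
      have := Real.sin_two_mul (θ/2)
      rw [show 2 * (θ/2) = θ by ring] at this
      exact this
    rw [Complex.exp_mul_I, c1, c2, ← Complex.ofReal_cos, ← Complex.ofReal_sin, c3, c4]
    push_cast
    ring
  rw [Complex.log_im, key]
  have hs : 0 < Real.sin (θ/2) := Real.sin_pos_of_pos_of_lt_pi (by linarith) (by linarith)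
  push_cast
  have := Complex.arg_mul_cos_add_sin_mul_I (r := 2 * Real.sin (θ/2)) (by positivity) (θ := (θ - Real.pi)/2) ⟨by linarith, by linarith⟩
  push_cast at this
  exact this

lemma hp_side (g k : ℝ → ℂ) (w : ℂ) (hg : Continuous g) (hk : Continuous k)
    (hk1 : ∀ t, ‖k t‖ ≤ 1) (hk2 : ∀ t, k t ≠ 1)
    (he : ∀ t, Complex.exp (g t) = w * (1 - k t)) (t₀ t₁ θ₀ θ₁ : ℝ)
    (h0 : k t₀ = Complex.exp (θ₀ * Complex.I)) (h1 : k t₁ = Complex.exp (θ₁ * Complex.I))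
    (a0 : 0 < θ₀) (b0 : θ₀ < 2 * Real.pi) (a1 : 0 < θ₁) (b1 : θ₁ < 2 * Real.pi) :
    (g t₁).im - (g t₀).im = (θ₁ - θ₀)/2 := by
  have hslit : ∀ t, 1 - k t ∈ Complex.slitPlane := by
    intro t
    by_cases hre : 0 < (1 - k t).re
    · exact Or.inl hre
    exfalso
    simp only [Complex.sub_re, Complex.one_re] at hre
    have h3 := Complex.abs_re_le_norm (k t)
    have h4 : (k t).re = 1 := by
      have := le_abs_self (k t).re
      linarith [hk1 t]
    have h5 : (k t).re^2 + (k t).im^2 ≤ 1 := by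
      have h6 := Complex.sq_norm (k t)
      rw [Complex.normSq_apply] at h6
      nlinarith [hk1 t, norm_nonneg (k t)]
    have h7 : (k t).im = 0 := by
      rw [h4] at h5
      have : (k t).im^2 ≤ 0 := by linarith
      nlinarith
    exact hk2 t (Complex.ext (by simpa using h4) (by simpa using h7))
  have hcont : Continuous (fun t => g t - Complex.log (1 - k t)) := by
    refine hg.sub ?_
    exact Continuous.clog (by fun_prop) hslit
  have hc := Complex.isCoveringMap_exp.const_of_comp hcont (fun t t' => by
    apply Subtype.ext
    have : ∀ t, Complex.exp (g t - Complex.log (1 - k t)) = w := by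
      intro t
      rw [Complex.exp_sub, he, Complex.exp_log (Complex.slitPlane_ne_zero (hslit t))]
      exact mul_div_cancel_right₀ _ (Complex.slitPlane_ne_zero (hslit t))
    simp only [this]) t₁ t₀
  have h2 := congrArg Complex.im hc
  simp only [Complex.sub_im] at h2
  rw [h0, h1, hp_arg _ a0 b0, hp_arg _ a1 b1] at h2
  linarith

lemma hp_cross (γ δ : ℝ → ℂ) (hγ : Continuous γ) (hδ : Continuous δ)
    (hγ1 : ∀ t, ‖γ t‖ < 1) (hδ1 : ∀ t, ‖δ t‖ < 1) (a b c d : ℝ)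
    (hab : a < b) (hbc : b < c) (hcd : c < d) (hda : d < a + 2 * Real.pi)
    (g0 : Tendsto γ atBot (𝓝 (Complex.exp (a * Complex.I))))
    (g1 : Tendsto γ atTop (𝓝 (Complex.exp (c * Complex.I))))
    (d0 : Tendsto δ atBot (𝓝 (Complex.exp (b * Complex.I))))
    (d1 : Tendsto δ atTop (𝓝 (Complex.exp (d * Complex.I)))) :
    ∃ s t, γ s = δ t := by
  by_contra hcon
  push Not at hcon
  obtain ⟨G, hG, hG0, hG1, hG2⟩ := hp_compactify γ hγ _ _ g0 g1
  obtain ⟨D, hD, hD0, hD1, hD2⟩ := hp_compactify δ hδ _ _ d0 d1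
  have ne : ∀ u v : ℝ, u < v → v < u + 2 * Real.pi →
      Complex.exp (u * Complex.I) ≠ Complex.exp (v * Complex.I) := by
    intro u v h1 h2 h
    rw [Complex.exp_eq_exp_iff_exists_int] at h
    obtain ⟨n, hn⟩ := h
    have hn' := congrArg Complex.im hn
    simp at hn'
    have hpi := Real.pi_pos
    have q1 : (n:ℝ) < 0 := by nlinarith
    have q2 : (-1:ℝ) < n := by nlinarith
    have q1' : n < 0 := by exact_mod_cast q1
    have q2' : -1 < n := by exact_mod_cast q2
    omega
  have nrm : ∀ u : ℝ, ‖Complex.exp (u * Complex.I)‖ = 1 := Complex.norm_exp_ofReal_mul_I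
  have nne : ∀ (u : ℝ) (z : ℂ), ‖z‖ < 1 → z ≠ Complex.exp (u * Complex.I) := by
    intro u z hz h
    rw [h, nrm] at hz
    exact lt_irrefl _ hz
  have GD : ∀ s t, G s ≠ D t := by
    intro s t
    rcases hG2 s with h | h | ⟨s', h⟩ <;> rcases hD2 t with h' | h' | ⟨t', h'⟩ <;> rw [h, h']
    · exact ne _ _ hab (by linarith)
    · exact ne _ _ (by linarith) hda
    · exact (nne _ _ (hδ1 _)).symm
    · exact (ne _ _ hbc (by linarith)).symm
    · exact ne _ _ hcd (by linarith)
    · exact (nne _ _ (hδ1 _)).symm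
    · exact nne _ _ (hγ1 _)
    · exact nne _ _ (hγ1 _)
    · exact hcon _ _
  have Gn : ∀ s, ‖G s‖ ≤ 1 := by
    intro s
    rcases hG2 s with h | h | ⟨s', h⟩ <;> rw [h]
    · exact (nrm _).le
    · exact (nrm _).le
    · exact (hγ1 _).le
  have Dn : ∀ s, ‖D s‖ ≤ 1 := by
    intro s
    rcases hD2 s with h | h | ⟨s', h⟩ <;> rw [h]
    · exact (nrm _).le
    · exact (nrm _).le
    · exact (hδ1 _).le
  obtain ⟨g, hg, hge⟩ := hp_lift (fun x => G x.1 - D x.2) (by fun_prop)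
    (fun x => sub_ne_zero.2 (GD _ _))
  have ediv : ∀ u v : ℝ, Complex.exp (u * Complex.I) / Complex.exp (v * Complex.I) =
      Complex.exp ((u - v : ℝ) * Complex.I) := by
    intro u v
    rw [← Complex.exp_sub]; push_cast; ring_nf
  have ediv' : ∀ u v : ℝ, Complex.exp (u * Complex.I) / Complex.exp (v * Complex.I) =
      Complex.exp ((u - v + 2 * Real.pi : ℝ) * Complex.I) := by
    intro u v
    rw [ediv]; push_cast
    rw [add_mul _ _ Complex.I, Complex.exp_add, Complex.exp_two_pi_mul_I, mul_one]
  have hpi := Real.pi_pos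
  set m := -(Real.pi/2)
  set M := Real.pi/2
  have ez : ∀ u : ℝ, Complex.exp (u * Complex.I) ≠ 0 := fun u => Complex.exp_ne_zero _
  have S1 := hp_side (fun t => g (m, t)) (fun t => D t / Complex.exp (a * Complex.I))
    (Complex.exp (a * Complex.I)) (by fun_prop) (by fun_prop)
    (fun t => by rw [norm_div, nrm, div_one]; exact Dn t)
    (fun t h => GD m t (by rw [hG0]; exact ((div_eq_one_iff_eq (ez _)).1 h).symm))
    (fun t => by rw [hge, mul_sub, mul_div_cancel₀ _ (ez _), mul_one, hG0])
    m M (b - a) (d - a) (by simp only [hD0]; exact ediv _ _) (by simp only [hD1]; exact ediv _ _)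
    (by linarith) (by linarith) (by linarith) (by linarith)
  have S2 := hp_side (fun t => g (M, t)) (fun t => D t / Complex.exp (c * Complex.I))
    (Complex.exp (c * Complex.I)) (by fun_prop) (by fun_prop)
    (fun t => by rw [norm_div, nrm, div_one]; exact Dn t)
    (fun t h => GD M t (by rw [hG1]; exact ((div_eq_one_iff_eq (ez _)).1 h).symm))
    (fun t => by rw [hge, mul_sub, mul_div_cancel₀ _ (ez _), mul_one, hG1])
    m M (b - c + 2 * Real.pi) (d - c) (by simp only [hD0]; exact ediv' _ _) (by simp only [hD1]; exact ediv _ _)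
    (by linarith) (by linarith) (by linarith) (by linarith)
  have S3 := hp_side (fun s => g (s, m)) (fun s => G s / Complex.exp (b * Complex.I))
    (-Complex.exp (b * Complex.I)) (by fun_prop) (by fun_prop)
    (fun t => by rw [norm_div, nrm, div_one]; exact Gn t)
    (fun t h => GD t m (by rw [hD0]; exact ((div_eq_one_iff_eq (ez _)).1 h)))
    (fun t => by rw [hge, mul_sub, neg_mul, neg_mul, mul_div_cancel₀ _ (ez _), mul_one, hD0]; ring)
    m M (a - b + 2 * Real.pi) (c - b) (by simp only [hG0]; exact ediv' _ _) (by simp only [hG1]; exact ediv _ _)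
    (by linarith) (by linarith) (by linarith) (by linarith)
  have S4 := hp_side (fun s => g (s, M)) (fun s => G s / Complex.exp (d * Complex.I))
    (-Complex.exp (d * Complex.I)) (by fun_prop) (by fun_prop)
    (fun t => by rw [norm_div, nrm, div_one]; exact Gn t)
    (fun t h => GD t M (by rw [hD1]; exact ((div_eq_one_iff_eq (ez _)).1 h)))
    (fun t => by rw [hge, mul_sub, neg_mul, neg_mul, mul_div_cancel₀ _ (ez _), mul_one, hD1]; ring)
    m M (a - d + 2 * Real.pi) (c - d + 2 * Real.pi) (by simp only [hG0]; exact ediv' _ _) (by simp only [hG1]; exact ediv' _ _)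
    (by linarith) (by linarith) (by linarith) (by linarith)
  linarith


section scarf
variable {I T L : Type*} [Fintype I] [DecidableEq I] [Fintype T] [DecidableEq T] [LinearOrder L]

/-- Scarf dominance. -/
def HpDom (r : I → T → L) (σ : Finset T) : Prop :=
  ∀ y, ∃ i, ∀ x ∈ σ, r i y ≤ r i x

/-- The elements above all minima except possibly that of index `a`. -/
def HpIsM (r : I → T → L) (m : I → T) (a : I) (y : T) : Prop := ∀ i, i ≠ a → r i (m i) < r i y

lemma hp_room_char (r : I → T → L) (hr : ∀ i, Function.Injective (r i)) (τ : Finset T)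
    (hd : HpDom r τ) (m : I → T) (hm : ∀ i, m i ∈ τ) (hmin : ∀ i, ∀ x ∈ τ, r i (m i) ≤ r i x)
    (a b : I) (hab : a ≠ b) (hmab : m a = m b)
    (huniq : ∀ i j, i ≠ j → m i = m j → (i = a ∧ j = b) ∨ (i = b ∧ j = a)) (x : T) :
    (x ∉ τ ∧ HpDom r (insert x τ)) ↔
      ((HpIsM r m a x ∧ ∀ y, HpIsM r m a y → r a y ≤ r a x) ∨
       (HpIsM r m b x ∧ ∀ y, HpIsM r m b y → r b y ≤ r b x)) := by
  have surj : ∀ z ∈ τ, ∀ i, (∀ x ∈ τ, r i z ≤ r i x) → z = m i := by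
    intro z hz i h
    exact hr i (le_antisymm (h _ (hm i)) (hmin i z hz))
  have back : ∀ a b : I, a ≠ b → m a = m b →
      (HpIsM r m a x ∧ ∀ y, HpIsM r m a y → r a y ≤ r a x) → (x ∉ τ ∧ HpDom r (insert x τ)) := by
    rintro a b hab hmab ⟨h1, h2⟩
    refine ⟨fun hx => ?_, fun y => ?_⟩
    · obtain ⟨k, hk⟩ := hd x
      have e := surj x hx k hk
      by_cases hka : k = a
      · subst hka
        have := h1 b hab.symm
        rw [← hmab, ← e] at this
        exact lt_irrefl _ this
      · have := h1 k hka
        rw [← e] at this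
        exact lt_irrefl _ this
    · by_cases hy : HpIsM r m a y
      · obtain ⟨i, hi⟩ := hd y
        have hia : i = a := by
          by_contra hne
          exact absurd (hi _ (hm i)) (not_le.2 (hy i hne))
        subst hia
        refine ⟨i, fun z hz => ?_⟩
        rcases Finset.mem_insert.1 hz with rfl | hz
        · exact h2 y hy
        · exact hi z hz
      · unfold HpIsM at hy
        push Not at hy
        obtain ⟨i, hia, hi⟩ := hy
        refine ⟨i, fun z hz => ?_⟩
        rcases Finset.mem_insert.1 hz with rfl | hz
        · exact hi.trans (h1 i hia).le
        · exact hi.trans (hmin i z hz)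
  have fwd : ∀ a b : I, a ≠ b → m a = m b →
      (∀ i j, i ≠ j → m i = m j → (i = a ∧ j = b) ∨ (i = b ∧ j = a)) →
      x ∉ τ → HpDom r (insert x τ) → r a x < r a (m a) →
      (HpIsM r m a x ∧ ∀ y, HpIsM r m a y → r a y ≤ r a x) := by
    intro a b hab hmab huniq hx hD hlt
    have h1 : HpIsM r m a x := by
      intro i hia
      obtain ⟨j, hj⟩ := hD (m i)
      have e := surj (m i) (hm i) j (fun z hz => hj z (Finset.mem_insert_of_mem hz))
      have hjx := hj x (Finset.mem_insert_self _ _)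
      have hji : j = i := by
        by_contra hne
        rcases huniq i j (Ne.symm hne) e with ⟨h, -⟩ | ⟨h, h'⟩
        · exact hia h
        · subst h'; rw [e] at hjx; exact absurd hjx (not_le.2 hlt)
      subst hji
      refine lt_of_le_of_ne hjx fun h => hx ?_
      rw [← hr j h]; exact hm j
    refine ⟨h1, fun y hy => ?_⟩
    obtain ⟨j, hj⟩ := hD y
    have hja : j = a := by
      by_contra hne
      exact absurd (hj _ (Finset.mem_insert_of_mem (hm j))) (not_le.2 (hy j hne))
    subst hja
    exact hj x (Finset.mem_insert_self _ _)
  constructor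
  · rintro ⟨hx, hD⟩
    obtain ⟨k, hk⟩ := hD x
    have hlt : r k x < r k (m k) := by
      refine lt_of_le_of_ne (hk _ (Finset.mem_insert_of_mem (hm k))) fun h => hx ?_
      rw [hr k h]; exact hm k
    by_cases hka : k = a
    · subst hka; exact Or.inl (fwd k b hab hmab huniq hx hD hlt)
    by_cases hkb : k = b
    · subst hkb
      exact Or.inr (fwd k a hab.symm hmab.symm (fun i j h h' => (huniq i j h h').symm) hx hD hlt)
    exfalso
    obtain ⟨i, hi⟩ := hD (m k)
    have e := surj (m k) (hm k) i (fun z hz => hi z (Finset.mem_insert_of_mem hz))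
    have hik : i = k := by
      by_contra hne
      rcases huniq k i (Ne.symm hne) e with ⟨h, -⟩ | ⟨h, -⟩
      · exact hka h
      · exact hkb h
    subst hik
    exact absurd (hi x (Finset.mem_insert_self _ _)) (not_le.2 hlt)
  · rintro (h | h)
    · exact back a b hab hmab h
    · exact back b a hab.symm hmab.symm h

/-- Existence and uniqueness of the argmax. -/
lemma hp_max_exists (r : I → T → L) (m : I → T) (a : I) (h : ∃ y, HpIsM r m a y) :
    ∃ x, HpIsM r m a x ∧ ∀ y, HpIsM r m a y → r a y ≤ r a x := by
  classical
  obtain ⟨y, hy⟩ := h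
  obtain ⟨x, hx, hx'⟩ := Finset.exists_max_image (Finset.univ.filter (HpIsM r m a)) (r a)
    ⟨y, by simpa using hy⟩
  exact ⟨x, by simpa using hx, fun y hy => hx' y (by simpa using hy)⟩

/-- Structure of a door. -/
lemma hp_door (r : I → T → L) (hr : ∀ i, Function.Injective (r i)) (τ : Finset T)
    (hd : HpDom r τ) (hne : τ.Nonempty) (hcard : τ.card + 1 = Fintype.card I) :
    ∃ (m : I → T) (a b : I), (∀ i, m i ∈ τ) ∧ (∀ i, ∀ x ∈ τ, r i (m i) ≤ r i x) ∧ a ≠ b ∧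
      m a = m b ∧ (∀ i j, i ≠ j → m i = m j → (i = a ∧ j = b) ∨ (i = b ∧ j = a)) := by
  classical
  choose m hm hmin using fun i => Finset.exists_min_image τ (r i) hne
  have surj : ∀ z ∈ τ, ∃ i, m i = z := by
    intro z hz
    obtain ⟨i, hi⟩ := hd z
    exact ⟨i, hr i (le_antisymm (hmin i z hz) (hi _ (hm i)))⟩
  obtain ⟨a, -, b, -, hab, hmab⟩ := Finset.exists_ne_map_eq_of_card_lt_of_maps_to
    (s := Finset.univ) (t := τ) (f := m) (by rw [Finset.card_univ]; omega) (fun i _ => hm i)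
  refine ⟨m, a, b, hm, hmin, hab, hmab, ?_⟩
  -- m is injective on univ \ {a}
  have himg : (Finset.univ.erase a).image m = τ := by
    ext z
    simp only [Finset.mem_image, Finset.mem_erase, Finset.mem_univ, and_true]
    constructor
    · rintro ⟨i, -, rfl⟩; exact hm i
    · intro hz
      obtain ⟨i, rfl⟩ := surj z hz
      by_cases h : i = a
      · exact ⟨b, hab.symm, by rw [h, hmab]⟩
      · exact ⟨i, h, rfl⟩
  have hinj : Set.InjOn m (Finset.univ.erase a : Finset I) := by
    apply Finset.injOn_of_card_image_eq
    rw [himg, Finset.card_erase_of_mem (Finset.mem_univ _), Finset.card_univ]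
    omega
  have hin : ∀ i j, i ≠ a → j ≠ a → m i = m j → i = j := fun i j hi hj h =>
    hinj (by simpa using hi) (by simpa using hj) h
  intro i j hij h
  by_cases hia : i = a
  · subst hia
    left; refine ⟨rfl, hin j b hij.symm hab.symm (by rw [← h, hmab])⟩
  · by_cases hja : j = a
    · subst hja
      right; exact ⟨hin i b hia hab.symm (by rw [h, hmab]), rfl⟩
    · exact absurd (hin i j hia hja h) hij

theorem hp_scarf (hI : 2 ≤ Fintype.card I) (r : I → T → L) (hr : ∀ i, Function.Injective (r i))
    (c : T → I) (s : I → T) (hcs : ∀ i, c (s i) = i) (hs : ∀ i y, r i (s i) ≤ r i y)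
    (hz : ∀ z, (∀ k, z ≠ s k) → ∀ i a, i ≠ a → r i z < r i (s a)) :
    ∃ σ : Finset T, HpDom r σ ∧ ∀ i, ∃ x ∈ σ, c x = i := by
  classical
  by_contra hcon
  push Not at hcon
  have : Nonempty I := Fintype.card_pos_iff.1 (by omega)
  let i₀ : I := Classical.arbitrary I
  let Rooms : Finset (Finset T) := Finset.univ.filter
    (fun σ => HpDom r σ ∧ σ.card = Fintype.card I)
  let Doors : Finset (Finset T) := Finset.univ.filter
    (fun τ => HpDom r τ ∧ τ.card + 1 = Fintype.card I ∧ τ.image c = Finset.univ.erase i₀)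
  let rel : Finset T → Finset T → Prop := fun τ σ => τ ⊆ σ
  have dc := Finset.sum_card_bipartiteAbove_eq_sum_card_bipartiteBelow (s := Doors) (t := Rooms) rel
  -- each room has an even number of doors
  have roomEven : ∀ σ ∈ Rooms, Even (Finset.card (Doors.bipartiteBelow rel σ)) := by
    intro σ hσ
    obtain ⟨hσd, hσc⟩ : HpDom r σ ∧ σ.card = Fintype.card I := by simpa [Rooms] using hσ
    rcases Finset.eq_empty_or_nonempty (Doors.bipartiteBelow rel σ) with h | ⟨τ, hτ⟩
    · rw [h]; simp
    have hτ' : (HpDom r τ ∧ τ.card + 1 = Fintype.card I ∧ τ.image c = Finset.univ.erase i₀) ∧ τ ⊆ σ := by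
      simpa [Finset.bipartiteBelow, Doors, rel] using hτ
    obtain ⟨⟨-, hτc, hτi⟩, hsub⟩ := hτ'
    have hinj : Set.InjOn c τ := by
      apply Finset.injOn_of_card_image_eq
      rw [hτi, Finset.card_erase_of_mem (Finset.mem_univ _), Finset.card_univ]; omega
    obtain ⟨x, hx, hxσ⟩ : ∃ x, x ∉ τ ∧ insert x τ = σ := by
      have := Finset.exists_eq_insert_iff.2 ⟨hsub, by omega⟩
      exact this
    have hcx : c x ≠ i₀ := by
      intro h
      obtain ⟨i, hi⟩ := hcon σ hσd
      by_cases hii : i = i₀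
      · exact hi x (by rw [← hxσ]; simp) (by rw [h, hii])
      · have : i ∈ τ.image c := by rw [hτi]; simpa using hii
        obtain ⟨z, hz, hzi⟩ := Finset.mem_image.1 this
        exact hi z (hsub hz) hzi
    obtain ⟨x', hx', hcx'⟩ : ∃ x' ∈ τ, c x' = c x := by
      have : c x ∈ τ.image c := by rw [hτi]; simpa using hcx
      simpa using this
    have hxx' : x ≠ x' := fun h => hx (h ▸ hx')
    have hset : Doors.bipartiteBelow rel σ = {σ.erase x, σ.erase x'} := by
      ext ρ
      simp only [Finset.bipartiteBelow, Finset.mem_filter, Doors, rel, Finset.mem_univ, true_and,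
        Finset.mem_insert, Finset.mem_singleton]
      constructor
      · rintro ⟨⟨-, hρc, hρi⟩, hρσ⟩
        obtain ⟨w, hw, hwσ⟩ := Finset.exists_eq_insert_iff.2 ⟨hρσ, by omega⟩
        have hρe : ρ = σ.erase w := by rw [← hwσ, Finset.erase_insert hw]
        have hwm : w ∈ σ := by rw [← hwσ]; simp
        have hinj' : Set.InjOn c ρ := by
          apply Finset.injOn_of_card_image_eq
          rw [hρi, Finset.card_erase_of_mem (Finset.mem_univ _), Finset.card_univ]; omega
        by_cases h1 : w = x
        · left; rw [hρe, h1]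
        by_cases h2 : w = x'
        · right; rw [hρe, h2]
        exfalso
        have m1 : x ∈ ρ := by
          rw [hρe]; refine Finset.mem_erase.2 ⟨Ne.symm h1, ?_⟩; rw [← hxσ]; simp
        have m2 : x' ∈ ρ := by
          rw [hρe]; exact Finset.mem_erase.2 ⟨Ne.symm h2, hsub hx'⟩
        exact hxx' (hinj' m1 m2 hcx'.symm)
      · have dsub : ∀ w, HpDom r (σ.erase w) := by
          intro w y
          obtain ⟨i, hi⟩ := hσd y
          exact ⟨i, fun z hz => hi z (Finset.mem_of_mem_erase hz)⟩
        have hxm : x ∈ σ := by rw [← hxσ]; simp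
        have e1 : σ.erase x = τ := by rw [← hxσ, Finset.erase_insert hx]
        have hpos : 0 < σ.card := Finset.card_pos.2 ⟨x, hxm⟩
        rintro (rfl | rfl)
        · refine ⟨⟨dsub x, ?_, ?_⟩, Finset.erase_subset _ _⟩
          · rw [e1, hτc]
          · rw [e1, hτi]
        · refine ⟨⟨dsub x', ?_, ?_⟩, Finset.erase_subset _ _⟩
          · rw [Finset.card_erase_of_mem (hsub hx')]; omega
          · rw [← hτi]
            ext i
            simp only [Finset.mem_image, Finset.mem_erase]
            constructor
            · rintro ⟨z, ⟨hzx, hz⟩, rfl⟩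
              rw [← hxσ] at hz
              rcases Finset.mem_insert.1 hz with rfl | hz
              · exact ⟨x', hx', hcx'⟩
              · exact ⟨z, hz, rfl⟩
            · rintro ⟨z, hz, rfl⟩
              by_cases hzx : z = x'
              · exact ⟨x, ⟨hxx', hxm⟩, by rw [hzx, hcx']⟩
              · exact ⟨z, ⟨hzx, hsub hz⟩, rfl⟩
    rw [hset, Finset.card_pair]
    · exact even_two
    · intro h
      have : x' ∈ σ.erase x := Finset.mem_erase.2 ⟨hxx'.symm, hsub hx'⟩
      rw [h] at this
      exact absurd rfl (Finset.mem_erase.1 this).1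
  -- counting rooms of a door
  have roomsOf : ∀ τ ∈ Doors, ∀ σ, σ ∈ Rooms.bipartiteAbove rel τ ↔
      ∃ x, σ = insert x τ ∧ x ∉ τ ∧ HpDom r (insert x τ) := by
    intro τ hτ σ
    obtain ⟨hτd, hτc, hτi⟩ : HpDom r τ ∧ τ.card + 1 = Fintype.card I ∧
      τ.image c = Finset.univ.erase i₀ := by simpa [Doors] using hτ
    simp only [Finset.bipartiteAbove, Finset.mem_filter, Rooms, rel, Finset.mem_univ, true_and]
    constructor
    · rintro ⟨⟨h1, h2⟩, h3⟩
      obtain ⟨x, hx, hxσ⟩ := Finset.exists_eq_insert_iff.2 ⟨h3, by omega⟩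
      exact ⟨x, hxσ.symm, hx, hxσ ▸ h1⟩
    · rintro ⟨x, rfl, hx, hd⟩
      exact ⟨⟨hd, by rw [Finset.card_insert_of_notMem hx, hτc]⟩, Finset.subset_insert _ _⟩
  have slackOuter : ∀ τ ∈ Doors, (∀ x ∈ τ, ∃ k, x = s k) → τ = (Finset.univ.erase i₀).image s := by
    intro τ hτ h
    obtain ⟨hτd, hτc, hτi⟩ : HpDom r τ ∧ τ.card + 1 = Fintype.card I ∧
      τ.image c = Finset.univ.erase i₀ := by simpa [Doors] using hτ
    rw [← hτi, Finset.image_image]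
    ext z
    simp only [Finset.mem_image, Function.comp]
    have key : ∀ w ∈ τ, s (c w) = w := by
      intro w hw
      obtain ⟨k, rfl⟩ := h w hw
      rw [hcs]
    constructor
    · intro hz; exact ⟨z, hz, key z hz⟩
    · rintro ⟨w, hw, rfl⟩; rw [key w hw]; exact hw
  let τ₀ : Finset T := (Finset.univ.erase i₀).image s
  have sinj : Function.Injective s := fun i j h => by rw [← hcs i, ← hcs j, h]
  have τ₀mem : ∀ z, z ∈ τ₀ ↔ ∃ k, k ≠ i₀ ∧ s k = z := by
    intro z; simp [τ₀]
  have τ₀Door : τ₀ ∈ Doors := by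
    simp only [Doors, Finset.mem_filter, Finset.mem_univ, true_and]
    refine ⟨?_, ?_, ?_⟩
    · intro y
      by_cases hy : ∃ k, y = s k
      · obtain ⟨k, rfl⟩ := hy
        exact ⟨k, fun x _ => hs k x⟩
      · push Not at hy
        refine ⟨i₀, fun x hx => ?_⟩
        obtain ⟨k, hk, rfl⟩ := (τ₀mem x).1 hx
        exact (hz y hy i₀ k hk.symm).le
    · rw [Finset.card_image_of_injective _ sinj, Finset.card_erase_of_mem (Finset.mem_univ _),
        Finset.card_univ]; omega
    · simp only [τ₀, Finset.image_image]
      have : c ∘ s = id := funext hcs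
      rw [this, Finset.image_id]
  have doorCount : ∀ τ ∈ Doors, τ ≠ τ₀ → Finset.card (Rooms.bipartiteAbove rel τ) = 2 := by
    intro τ hτ hne
    obtain ⟨hτd, hτc, hτi⟩ : HpDom r τ ∧ τ.card + 1 = Fintype.card I ∧
      τ.image c = Finset.univ.erase i₀ := by simpa [Doors] using hτ
    have hτne : τ.Nonempty := Finset.card_pos.1 (by omega)
    obtain ⟨m, a, b, hm, hmin, hab, hmab, huniq⟩ := hp_door r hr τ hτd hτne hτc
    obtain ⟨z, hzτ, hzs⟩ : ∃ z ∈ τ, ∀ k, z ≠ s k := by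
      by_contra hh
      push Not at hh
      exact hne (slackOuter τ hτ hh)
    have hM : ∀ a, HpIsM r m a (s a) := fun a i hia =>
      lt_of_le_of_lt (hmin i z hzτ) (hz z hzs i a hia)
    obtain ⟨x, hx1, hx2⟩ := hp_max_exists r m a ⟨_, hM a⟩
    obtain ⟨y, hy1, hy2⟩ := hp_max_exists r m b ⟨_, hM b⟩
    have hxy : x ≠ y := by
      rintro rfl
      obtain ⟨i, hi⟩ := hτd x
      have h2 : r i (m i) < r i x := by
        by_cases h : i = a
        · exact hy1 i (by rw [h]; exact hab)
        · exact hx1 i h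
      exact absurd (hi _ (hm i)) (not_le.2 h2)
    have char := hp_room_char r hr τ hτd m hm hmin a b hab hmab huniq
    have hxd := (char x).2 (Or.inl ⟨hx1, hx2⟩)
    have hyd := (char y).2 (Or.inr ⟨hy1, hy2⟩)
    have hset : Rooms.bipartiteAbove rel τ = {insert x τ, insert y τ} := by
      ext σ
      rw [roomsOf τ hτ, Finset.mem_insert, Finset.mem_singleton]
      constructor
      · rintro ⟨w, rfl, hw⟩
        rcases (char w).1 hw with ⟨h1, h2⟩ | ⟨h1, h2⟩
        · left; rw [hr a (le_antisymm (hx2 _ h1) (h2 _ hx1))]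
        · right; rw [hr b (le_antisymm (hy2 _ h1) (h2 _ hy1))]
      · rintro (rfl | rfl)
        · exact ⟨x, rfl, hxd⟩
        · exact ⟨y, rfl, hyd⟩
    rw [hset, Finset.card_pair]
    intro h
    have : x ∈ insert y τ := by rw [← h]; simp
    rcases Finset.mem_insert.1 this with h | h
    · exact hxy h
    · exact hxd.1 h
  have door0 : Finset.card (Rooms.bipartiteAbove rel τ₀) = 1 := by
    obtain ⟨hτd, hτc, hτi⟩ : HpDom r τ₀ ∧ τ₀.card + 1 = Fintype.card I ∧
      τ₀.image c = Finset.univ.erase i₀ := by simpa [Doors] using τ₀Door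
    have hτne : τ₀.Nonempty := Finset.card_pos.1 (by omega)
    obtain ⟨m, a, b, hm, hmin, hab, hmab, huniq⟩ := hp_door r hr τ₀ hτd hτne hτc
    have hms : ∀ j, j ≠ i₀ → m j = s j := fun j hj =>
      hr j (le_antisymm (hmin j _ ((τ₀mem _).2 ⟨j, hj, rfl⟩)) (hs j _))
    -- wlog a = i₀
    have aux : ∃ b, i₀ ≠ b ∧ m i₀ = m b ∧
        (∀ i j, i ≠ j → m i = m j → (i = i₀ ∧ j = b) ∨ (i = b ∧ j = i₀)) := by
      by_cases ha : a = i₀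
      · subst ha; exact ⟨b, hab, hmab, huniq⟩
      by_cases hb : b = i₀
      · subst hb; exact ⟨a, hab.symm, hmab.symm, fun i j h h' => (huniq i j h h').symm⟩
      · exfalso; rw [hms a ha, hms b hb] at hmab; exact hab (sinj hmab)
    obtain ⟨b, hib, hmib, hu⟩ := aux
    have hM : HpIsM r m i₀ (s i₀) := by
      intro i hi
      rw [hms i hi]
      exact lt_of_le_of_ne (hs i _) fun h => hi (sinj (hr i h))
    have hMb : ∀ y, ¬ HpIsM r m b y := by
      intro y hy
      have h1 := hy i₀ hib
      rw [hmib, hms b hib.symm] at h1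
      by_cases hys : ∃ k, y = s k
      · obtain ⟨k, rfl⟩ := hys
        by_cases hk : k = i₀
        · subst hk; exact absurd (hs _ _) (not_le.2 h1)
        · by_cases hkb : k = b
          · subst hkb; exact lt_irrefl _ h1
          · have := hy k hkb
            rw [hms k hk] at this
            exact lt_irrefl _ this
      · push Not at hys
        exact absurd h1 (hz y hys i₀ b hib).not_gt
    obtain ⟨x, hx1, hx2⟩ := hp_max_exists r m i₀ ⟨_, hM⟩
    have char := hp_room_char r hr τ₀ hτd m hm hmin i₀ b hib hmib hu
    have hset : Rooms.bipartiteAbove rel τ₀ = {insert x τ₀} := by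
      ext σ
      rw [roomsOf τ₀ τ₀Door, Finset.mem_singleton]
      constructor
      · rintro ⟨w, rfl, hw⟩
        rcases (char w).1 hw with ⟨h1, h2⟩ | ⟨h1, h2⟩
        · rw [hr i₀ (le_antisymm (hx2 _ h1) (h2 _ hx1))]
        · exact absurd h1 (hMb w)
      · rintro rfl
        exact ⟨x, rfl, (char x).2 (Or.inl ⟨hx1, hx2⟩)⟩
    rw [hset, Finset.card_singleton]
  have evenR : Even (∑ σ ∈ Rooms, Finset.card (Doors.bipartiteBelow rel σ)) :=
    Finset.even_sum _ roomEven
  rw [← dc, ← Finset.add_sum_erase _ _ τ₀Door, door0] at evenR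
  have evenD : Even (∑ τ ∈ Doors.erase τ₀, Finset.card (Rooms.bipartiteAbove rel τ)) := by
    apply Finset.even_sum
    intro τ hτ
    rw [doorCount τ (Finset.mem_of_mem_erase hτ) (Finset.mem_erase.1 hτ).1]
    exact even_two
  obtain ⟨u, hu⟩ := evenR
  obtain ⟨v, hv⟩ := evenD
  omega
end scarf

lemma hp_angle (a : ℝ) (z : ℂ) (hz : ‖z‖ = 1) (hne : z ≠ Complex.exp (a * Complex.I)) :
    ∃ d : ℝ, a < d ∧ d < a + 2 * Real.pi ∧ z = Complex.exp (d * Complex.I) := by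
  have hpi := Real.two_pi_pos
  have h1 : z = Complex.exp (z.arg * Complex.I) := by
    have := Complex.norm_mul_exp_arg_mul_I z
    rw [hz] at this
    simpa using this.symm
  have hm := toIcoMod_mem_Ico hpi a z.arg
  have h2 : z = Complex.exp ((toIcoMod hpi a z.arg : ℝ) * Complex.I) := by
    have e : toIcoMod hpi a z.arg = z.arg - toIcoDiv hpi a z.arg * (2 * Real.pi) := by
      rw [toIcoMod, zsmul_eq_mul]
    rw [e]
    nth_rewrite 1 [h1]
    rw [Complex.exp_eq_exp_iff_exists_int]
    exact ⟨toIcoDiv hpi a z.arg, by push_cast; ring⟩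
  refine ⟨_, lt_of_le_of_ne hm.1 fun h => hne ?_, hm.2, h2⟩
  rw [← h] at h2
  exact h2

lemma hp_exp_shift (u v w : ℝ) (h : Complex.exp (u * Complex.I) = Complex.exp (v * Complex.I)) :
    Complex.exp ((w - (u - v) : ℝ) * Complex.I) = Complex.exp (w * Complex.I) := by
  have : ((w - (u - v) : ℝ) : ℂ) * Complex.I = w * Complex.I - (u * Complex.I - v * Complex.I) := by
    push_cast; ring
  rw [this, Complex.exp_sub, Complex.exp_sub, h, div_self (Complex.exp_ne_zero _), div_one]

lemma hp_order (n : ℕ) (Γ : ZMod n → ℝ → ↥Disk) (α ω : ZMod n → ℂ)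
    (hG : SettingG n Γ α ω) (i : ZMod n) (z : ℂ) (hz : ‖z‖ = 1) (z1 : z ≠ α i) (z2 : z ≠ ω i)
    (z3 : z ≠ ω (i - 1)) (z4 : ¬ InCcwArc (ω (i - 1 - 1)) (ω (i - 1)) z)
    (z5 : ¬ InCcwArc (ω (i - 1)) (ω i) z) :
    ∃ a b c d : ℝ, a < b ∧ b < c ∧ c < d ∧ d < a + 2 * Real.pi ∧
      α i = Complex.exp (a * Complex.I) ∧ α (i + 1) = Complex.exp (b * Complex.I) ∧
      ω i = Complex.exp (c * Complex.I) ∧ z = Complex.exp (d * Complex.I) := by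
  obtain ⟨a0, a, b0, h1, h2, h3, e1, e2, e3⟩ := hG.arcMem (i - 1)
  rw [sub_add_cancel] at e2
  obtain ⟨b1, b2, c1, k1, k2, k3, f1, f2, f3⟩ := hG.arcMem i
  have hb : Complex.exp (b1 * Complex.I) = Complex.exp (b0 * Complex.I) := by rw [← f1, ← e3]
  have sb := hp_exp_shift _ _ b2 hb
  have sc := hp_exp_shift _ _ c1 hb
  rw [← f2] at sb
  rw [← f3] at sc
  generalize hbb : b2 - (b1 - b0) = b at sb
  generalize hcc : c1 - (b1 - b0) = c at sc
  have per : ∀ u : ℝ, Complex.exp ((u - 2 * Real.pi : ℝ) * Complex.I) = Complex.exp (u * Complex.I) := by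
    intro u
    have : ((u - 2 * Real.pi : ℝ) : ℂ) * Complex.I = u * Complex.I - 2 * Real.pi * Complex.I := by
      push_cast; ring
    rw [this, Complex.exp_sub, Complex.exp_two_pi_mul_I, div_one]
  have hc : c < a + 2 * Real.pi := by
    by_contra hh
    push Not at hh
    rcases eq_or_lt_of_le hh with h | h
    · apply hG.αω i i
      rw [e2, ← sc, ← per c, ← h]; congr 3; ring
    · apply hG.arcNoω (i - 1) i
      exact ⟨a0, c - 2 * Real.pi, b0, by linarith, by linarith, h3, e1, by rw [per, sc], e3⟩
  obtain ⟨d, d1, d2, d3⟩ := hp_angle a z hz (by rw [← e2]; exact z1)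
  refine ⟨a, b, c, d, by linarith, by linarith, ?_, d2, e2, sb.symm, sc.symm, d3⟩
  by_contra hh
  push Not at hh
  rcases lt_trichotomy d b0 with h | h | h
  · exact z4 ⟨a0, d, b0, by linarith, h, h3, e1, d3, e3⟩
  · exact z3 (by rw [d3, h, e3])
  rcases eq_or_lt_of_le hh with h' | h'
  · exact z2 (by rw [d3, h', sc])
  · exact z5 ⟨b0, d, c, h, h', by linarith, e3, d3, sc.symm⟩

lemma hp_zmod {n : ℕ} (hn : 3 ≤ n) : (1 : ZMod n) ≠ 0 ∧ (2 : ZMod n) ≠ 0 := by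
  constructor
  · intro h
    have : ((1 : ℕ) : ZMod n) = 0 := by exact_mod_cast h
    rw [ZMod.natCast_eq_zero_iff] at this
    have := Nat.le_of_dvd (by norm_num) this
    omega
  · intro h
    have : ((2 : ℕ) : ZMod n) = 0 := by exact_mod_cast h
    rw [ZMod.natCast_eq_zero_iff] at this
    have := Nat.le_of_dvd (by norm_num) this
    omega

lemma hp_meet (n : ℕ) (Γ : ZMod n → ℝ → ↥Disk) (α ω : ZMod n → ℂ)
    (hG : SettingG n Γ α ω) (i : ZMod n) : ∃ s t, Γ i s = Γ (i + 1) t := by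
  obtain ⟨h10, h20⟩ := hp_zmod hG.hn
  obtain ⟨a, b, c, d, h1, h2, h3, h4, e1, e2, e3, e4⟩ := hp_order n Γ α ω hG i (ω (i + 1))
    (by simpa using hG.ωmem (i + 1)) (hG.αω _ _).symm
    (fun h => h10 (by have := hG.ωinj h; simpa using this))
    (fun h => h20 (by
      have := hG.ωinj h
      have h' : (i + 1) - (i - 1) = 0 := sub_eq_zero.2 this
      rw [← h']; ring))
    (hG.arcNoω _ _) (hG.arcNoω _ _)
  obtain ⟨s, t, hst⟩ := hp_cross (fun t => (Γ i t).1) (fun t => (Γ (i + 1) t).1)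
    (continuous_subtype_val.comp (hG.cont _)) (continuous_subtype_val.comp (hG.cont _))
    (fun t => mem_ball_zero_iff.1 (Γ i t).2) (fun t => mem_ball_zero_iff.1 (Γ (i + 1) t).2)
    a b c d h1 h2 h3 h4 (e1 ▸ hG.limBot i) (e3 ▸ hG.limTop i) (e2 ▸ hG.limBot (i + 1))
    (e4 ▸ hG.limTop (i + 1))
  exact ⟨s, t, Subtype.ext hst⟩

lemma hp_meet2 (n : ℕ) (Γ : ZMod n → ℝ → ↥Disk) (α ω : ZMod n → ℂ)
    (hG : SettingG n Γ α ω) (i j : ZMod n) (hj1 : j ≠ i) (hj2 : j ≠ i + 1) (s s' : ℝ)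
    (hss : Γ (i + 1) s = Γ j s') :
    (∃ q r, r ≤ s ∧ Γ i q = Γ (i + 1) r) ∨ (∃ q r, r ≤ s' ∧ Γ i q = Γ j r) := by
  obtain ⟨a, b, c, d, h1, h2, h3, h4, e1, e2, e3, e4⟩ := hp_order n Γ α ω hG i (α j)
    (by simpa using hG.αmem j) (fun h => hj1 (hG.αinj h))
    (hG.αω _ _) (hG.αω _ _) (fun h => hj1 (by simpa using hG.arcOnlyα _ _ h))
    (fun h => hj2 (hG.arcOnlyα _ _ h))
  have cv : ∀ k, Continuous fun t => (Γ k t).1 := fun k => continuous_subtype_val.comp (hG.cont k)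
  obtain ⟨q, t, hqt⟩ := hp_cross (fun t => (Γ i t).1)
    (fun t => if t ≤ 0 then (Γ (i + 1) (s + t)).1 else (Γ j (s' - t)).1)
    (cv i)
    (Continuous.if_le ((cv (i+1)).comp (by fun_prop : Continuous fun t : ℝ => s + t))
      ((cv j).comp (by fun_prop : Continuous fun t : ℝ => s' - t)) continuous_id continuous_const
      (by rintro t rfl; simp [hss]))
    (fun t => mem_ball_zero_iff.1 (Γ i t).2)
    (fun t => by
      split_ifs
      · exact mem_ball_zero_iff.1 (Γ (i + 1) (s + t)).2
      · exact mem_ball_zero_iff.1 (Γ j (s' - t)).2)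
    a b c d h1 h2 h3 h4 (e1 ▸ hG.limBot i) (e3 ▸ hG.limTop i)
    (by
      rw [← e2]
      refine Tendsto.congr' ?_ ((hG.limBot (i + 1)).comp (tendsto_atBot_add_const_left atBot s tendsto_id))
      filter_upwards [eventually_le_atBot (0:ℝ)] with t ht
      simp [ht])
    (by
      rw [← e4]
      have hh : Tendsto (fun t : ℝ => s' - t) atTop atBot := by
        simpa [sub_eq_add_neg] using tendsto_atBot_add_const_left atTop s' tendsto_neg_atTop_atBot
      refine Tendsto.congr' ?_ ((hG.limBot j).comp hh)
      filter_upwards [eventually_gt_atTop (0:ℝ)] with t ht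
      simp [not_le.2 ht])
  split_ifs at hqt with ht
  · exact Or.inl ⟨q, s + t, by linarith, Subtype.ext hqt⟩
  · exact Or.inr ⟨q, s' - t, by linarith, Subtype.ext hqt⟩

/-- The crossings. -/
def HpX (n : ℕ) (Γ : ZMod n → ℝ → ↥Disk) : Set (ZMod n × ZMod n × ℝ × ℝ) :=
  {p | p.1 ≠ p.2.1 ∧ Γ p.1 p.2.2.1 = Γ p.2.1 p.2.2.2}

lemma hp_finite (n : ℕ) (Γ : ZMod n → ℝ → ↥Disk) (α ω : ZMod n → ℂ)
    (hG : SettingG n Γ α ω) : (HpX n Γ).Finite := by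
  have : NeZero n := ⟨by have := hG.hn; omega⟩
  have hfin : (⋃ i : ZMod n, ⋃ j : ZMod n, ⋃ (_ : i ≠ j),
      (({i} : Set (ZMod n)) ×ˢ (({j} : Set (ZMod n)) ×ˢ
        (Set.range (Γ i) ∩ Set.range (Γ j))))).Finite := by
    refine Set.finite_iUnion fun i => Set.finite_iUnion fun j => Set.finite_iUnion fun h => ?_
    exact (Set.finite_singleton i).prod ((Set.finite_singleton j).prod (hG.finInter i j h))
  refine Set.Finite.of_finite_image
    (f := fun p : ZMod n × ZMod n × ℝ × ℝ => (p.1, p.2.1, Γ p.1 p.2.2.1)) (hfin.subset ?_) ?_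
  · rintro _ ⟨⟨i, j, s, s'⟩, ⟨h1, h2⟩, rfl⟩
    simp only [Set.mem_iUnion]
    exact ⟨i, j, h1, rfl, rfl, ⟨s, rfl⟩, ⟨s', h2.symm⟩⟩
  · rintro ⟨i, j, s, s'⟩ ⟨h1, h2⟩ ⟨i', j', u, u'⟩ ⟨h1', h2'⟩ h
    simp only [Prod.mk.injEq] at h h1 h2 h1' h2'
    obtain ⟨rfl, rfl, h⟩ := h
    have hx : Γ i s ∈ Set.range (Γ i) ∩ Set.range (Γ j) := ⟨⟨s, rfl⟩, ⟨s', h2.symm⟩⟩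
    have a1 := hG.noDouble i j h1 _ hx s u rfl h.symm
    have a2 := hG.noDouble j i h1.symm (Γ i s) hx.symm s' u' h2.symm (by rw [← h2', h])
    rw [a1, a2]

/-- Tier and value of an element in the order of index `k`. -/
def hpTier {n : ℕ} {Γ : ZMod n → ℝ → ↥Disk} (k : ZMod n) : HpX n Γ ⊕ ZMod n → ℕ
  | Sum.inl x => if x.1.1 = k ∨ x.1.2.1 = k then 1 else 2
  | Sum.inr l => if l = k then 0 else 3

def hpVal {n : ℕ} {Γ : ZMod n → ℝ → ↥Disk} (k : ZMod n) : HpX n Γ ⊕ ZMod n → ℝ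
  | Sum.inl x => if x.1.1 = k then - x.1.2.2.1 else if x.1.2.1 = k then - x.1.2.2.2 else 0
  | Sum.inr _ => 0

def hpCol {n : ℕ} {Γ : ZMod n → ℝ → ↥Disk} : HpX n Γ ⊕ ZMod n → ZMod n
  | Sum.inl x => if x.1.2.1 = x.1.1 - 1 then x.1.2.1 else x.1.1
  | Sum.inr l => l

lemma hp_tier_a {n : ℕ} {Γ : ZMod n → ℝ → ↥Disk} (i : ZMod n) (x : HpX n Γ) :
    hpTier (Γ := Γ) i (Sum.inr i) < hpTier i (Sum.inl x) := by
  simp only [hpTier, if_true]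
  split_ifs <;> norm_num

lemma hp_tier_b {n : ℕ} {Γ : ZMod n → ℝ → ↥Disk} (x : HpX n Γ) :
    hpTier (hpCol (Sum.inl x)) (Sum.inl x) ≤ 1 := by
  have h : x.1.1 = hpCol (Sum.inl x) ∨ x.1.2.1 = hpCol (Sum.inl x) := by
    by_cases h : x.1.2.1 = x.1.1 - 1
    · right; exact (if_pos h).symm
    · left; exact (if_neg h).symm
  exact (if_pos h).le

set_option maxHeartbeats 1000000 in
lemma hp_comb (n : ℕ) (Γ : ZMod n → ℝ → ↥Disk) (α ω : ZMod n → ℂ)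
    (hG : SettingG n Γ α ω) :
    ∃ (S : Set (ZMod n)) (Q : ZMod n → ℝ → Prop), (∀ k, {v | Q k v}.Finite) ∧
      (∀ i j s s', i ≠ j → Γ i s = Γ j s' →
        (i ∉ S ∧ ∀ v, Q i v → v ≤ s) ∨ (j ∉ S ∧ ∀ v, Q j v → v ≤ s')) ∧
      (∀ i, i ∈ S ∨ ∃ j s s', j ≠ i - 1 ∧ j ≠ i ∧ Γ i s = Γ j s' ∧ Q i s ∧ Q j s') := by
  classical
  obtain ⟨h10, h20⟩ := hp_zmod hG.hn
  have : NeZero n := ⟨by have := hG.hn; omega⟩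
  have : Finite (HpX n Γ) := (hp_finite n Γ α ω hG).to_subtype
  let _ : Fintype (HpX n Γ) := Fintype.ofFinite _
  let e := Fintype.equivFin (HpX n Γ ⊕ ZMod n)
  let r : ZMod n → (HpX n Γ ⊕ ZMod n) → ℕ ×ₗ ℝ ×ₗ ℕ := fun k y =>
    toLex (hpTier k y, toLex (hpVal k y, (e y : ℕ)))
  have rle : ∀ k x y, r k y ≤ r k x → hpTier k y ≤ hpTier k x ∧
      (hpTier k y = hpTier k x → hpVal k y ≤ hpVal k x) := by
    intro k x y h
    simp only [r, Prod.Lex.toLex_le_toLex] at h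
    rcases h with h | ⟨h, h'⟩
    · exact ⟨h.le, fun h' => absurd h' h.ne⟩
    · refine ⟨h.le, fun _ => ?_⟩
      rcases h' with h' | ⟨h', -⟩
      · exact h'.le
      · exact h'.le
  have rlt : ∀ k x y, hpTier k y < hpTier k x → r k y < r k x := by
    intro k x y h
    simp only [r, Prod.Lex.toLex_lt_toLex]
    exact Or.inl h
  obtain ⟨σ, hd, hc⟩ := hp_scarf (I := ZMod n) (T := HpX n Γ ⊕ ZMod n)
    (by rw [ZMod.card]; have := hG.hn; omega) r
    (by
      intro k x y h
      simp only [r, EmbeddingLike.apply_eq_iff_eq, Prod.mk.injEq] at h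
      exact e.injective (Fin.ext h.2.2))
    hpCol Sum.inr (fun i => rfl)
    (by
      intro i y
      by_cases h : y = Sum.inr i
      · rw [h]
      · apply le_of_lt
        apply rlt
        rcases y with x | l
        · exact hp_tier_a i x
        · have : l ≠ i := fun h' => h (by rw [h'])
          simp [hpTier, this])
    (by
      intro z hz i a hia
      apply rlt
      rcases z with x | l
      · simp only [hpTier, if_neg hia.symm]; split_ifs <;> norm_num
      · exact absurd rfl (hz l))
  have tier1 : ∀ k, ∃ x ∈ σ, hpTier k x ≤ 1 := by
    intro k
    obtain ⟨x, hx, rfl⟩ := hc k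
    refine ⟨x, hx, ?_⟩
    rcases x with x | l
    · exact hp_tier_b x
    · simp [hpTier, hpCol]
  let Q : ZMod n → ℝ → Prop := fun k v => ∃ x : HpX n Γ, Sum.inl x ∈ σ ∧
    ((x.1.1 = k ∧ x.1.2.2.1 = v) ∨ (x.1.2.1 = k ∧ x.1.2.2.2 = v))
  have hQval : ∀ k v, Q k v → ∃ x ∈ σ, hpTier k x = 1 ∧ hpVal k x = - v := by
    rintro k v ⟨x, hx, ⟨rfl, rfl⟩ | ⟨rfl, rfl⟩⟩
    · exact ⟨_, hx, by simp [hpTier], by simp [hpVal]⟩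
    · exact ⟨_, hx, by simp [hpTier], by simp [hpVal, x.2.1]⟩
  refine ⟨{k | Sum.inr k ∈ σ}, Q, ?_, ?_, ?_⟩
  · intro k
    refine ((Set.finite_range (fun x : HpX n Γ => x.1.2.2.1)).union
      (Set.finite_range (fun x : HpX n Γ => x.1.2.2.2))).subset ?_
    rintro v ⟨x, -, ⟨-, h⟩ | ⟨-, h⟩⟩
    · exact Or.inl ⟨x, h⟩
    · exact Or.inr ⟨x, h⟩
  · intro i j s s' hij hss
    let y : HpX n Γ := ⟨(i, j, s, s'), hij, hss⟩
    obtain ⟨k, hk⟩ := hd (Sum.inl y)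
    obtain ⟨x0, hx0, hx1⟩ := tier1 k
    have hy1 : hpTier k (Sum.inl y) = 1 := by
      have := (rle _ _ _ (hk x0 hx0)).1.trans hx1
      revert this
      simp only [hpTier]; split_ifs <;> simp
    have hkS : Sum.inr k ∉ σ := by
      intro h
      have := (rle _ _ _ (hk _ h)).1
      rw [hy1] at this
      simp [hpTier] at this
    have hv : ∀ v, Q k v → hpVal k (Sum.inl y) ≤ - v := by
      intro v hv
      obtain ⟨x, hx, ht, hxv⟩ := hQval k v hv
      rw [← hxv]
      exact (rle _ _ _ (hk x hx)).2 (by rw [hy1, ht])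
    have hik : i = k ∨ j = k := by
      by_contra hh
      simp [hpTier, y, hh] at hy1
    rcases hik with rfl | rfl
    · left
      refine ⟨hkS, fun v h => ?_⟩
      have := hv v h
      simp [hpVal, y] at this
      exact this
    · right
      refine ⟨hkS, fun v h => ?_⟩
      have := hv v h
      simp [hpVal, y, hij] at this
      exact this
  · intro i
    obtain ⟨x, hx, hxi⟩ := hc i
    rcases x with x | l
    · right
      obtain ⟨⟨p, q, s, s'⟩, h1, h2⟩ := x
      simp only [hpCol] at hxi
      simp only at h1 h2
      split_ifs at hxi with hq
      · subst hxi
        refine ⟨p, s', s, ?_, h1, h2.symm, ⟨_, hx, Or.inr ⟨rfl, rfl⟩⟩, ⟨_, hx, Or.inl ⟨rfl, rfl⟩⟩⟩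
        intro hp
        apply h20
        have : (q - (p - 1)) + ((p : ZMod n) - (q - 1)) = 0 := by
          rw [sub_eq_zero.2 hq, sub_eq_zero.2 hp, add_zero]
        rw [← this]; ring
      · subst hxi
        exact ⟨q, s, s', hq, h1.symm, h2, ⟨_, hx, Or.inl ⟨rfl, rfl⟩⟩, ⟨_, hx, Or.inr ⟨rfl, rfl⟩⟩⟩
    · left
      have : l = i := hxi
      rw [← this]; exact hx

/-- Proposition 5.1. -/
theorem handel_prop_5_1 (n : ℕ) (Γ : ZMod n → ℝ → ↥Disk) (α ω : ZMod n → ℂ)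
    (hG : SettingG n Γ α ω) :
    ∃ t : ZMod n → ℝ, CondA n Γ t ∧ ∀ i, i ∈ SigmaSet n Γ t := by
  obtain ⟨h10, h20⟩ := hp_zmod hG.hn
  obtain ⟨S, Q, hfin, hdom, hlab⟩ := hp_comb n Γ α ω hG
  have hS : ∀ i, i ∉ S := by
    intro i hi
    have hii : i ≠ i + 1 := fun h => h10 (by simpa using h)
    have triple : ∀ j, j ≠ i → j ≠ i + 1 → ∀ q s s', Γ (i + 1) s = Γ j s' →
        Γ i q = Γ (i + 1) s → False := by
      intro j hj1 hj2 q s s' e1 e2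
      have := hG.noTripleCurve i (i + 1) j hii hj1.symm hj2.symm
      have hm : Γ i q ∈ Set.range (Γ i) ∩ Set.range (Γ (i + 1)) ∩ Set.range (Γ j) :=
        ⟨⟨⟨q, rfl⟩, ⟨s, e2.symm⟩⟩, ⟨s', by rw [e2, e1]⟩⟩
      rw [this] at hm
      exact hm
    have hi1 : i + 1 ∉ S := by
      obtain ⟨s, t, hst⟩ := hp_meet n Γ α ω hG i
      rcases hdom i (i + 1) s t hii hst with h | h
      · exact absurd hi h.1
      · exact h.1
    rcases hlab (i + 1) with h | ⟨j, s, s', hj1, hj2, hss, q1, q2⟩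
    · exact hi1 h
    rw [add_sub_cancel_right] at hj1
    rcases hp_meet2 n Γ α ω hG i j hj1 hj2 s s' hss with ⟨q, t, ht, hqt⟩ | ⟨q, t, ht, hqt⟩
    · rcases hdom i (i + 1) q t hii hqt with h | h
      · exact h.1 hi
      · have := h.2 s q1
        have hts : t = s := le_antisymm ht this
        subst hts
        exact triple j hj1 hj2 q t s' hss hqt
    · rcases hdom i j q t hj1.symm hqt with h | h
      · exact h.1 hi
      · have := h.2 s' q2
        have hts : t = s' := le_antisymm ht this
        subst hts
        exact triple j hj1 hj2 q s t hss (by rw [hqt, hss])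
  have hlab' : ∀ i, ∃ j s s', j ≠ i - 1 ∧ j ≠ i ∧ Γ i s = Γ j s' ∧ Q i s ∧ Q j s' := fun i =>
    (hlab i).resolve_left (hS i)
  have hmax : ∀ i, ∃ v, Q i v ∧ ∀ w, Q i w → w ≤ v := by
    intro i
    obtain ⟨j, s, s', -, -, -, hq, -⟩ := hlab' i
    obtain ⟨v, hv, hv'⟩ := Set.exists_max_image {v | Q i v} id (hfin i) ⟨s, hq⟩
    exact ⟨v, hv, fun w hw => hv' w hw⟩
  choose t ht1 ht2 using hmax
  refine ⟨t, ?_, ?_⟩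
  · intro i j hij
    rw [Set.disjoint_left]
    rintro x ⟨s, hs, rfl⟩ ⟨s', hs', he⟩
    rcases hdom i j s s' hij he.symm with h | h
    · exact absurd (h.2 _ (ht1 i)) (not_le.2 hs)
    · exact absurd (h.2 _ (ht1 j)) (not_le.2 hs')
  · intro i
    obtain ⟨j, s, s', hj1, hj2, hss, hq, hq'⟩ := hlab' i
    exact ⟨j, hj1, hj2, Γ i s, ⟨s, ht2 i s hq, rfl⟩, ⟨s', ht2 j s' hq', hss.symm⟩⟩
end
end

section
/- Under Setting (G), fix K > 0 such that Γ_i((−∞,−K]) ∩ Γ_{i'}(ℝ) = ∅ and Γ_i([K,+∞)) ∩ Γ_{i'}(ℝ) = ∅ whenever i ≠ i'. Let T = (t_i)_{i∈ℤ/nℤ} be a configuration satisfying (A). Then: (1) for every i ∈ Σ(T), one has t_i > −K and t_{i−1} < K; (2) the configurations T' = (min(t_i, K))_{i∈ℤ/nℤ}, T'' = (max(t_i, −K))_{i∈ℤ/nℤ} and T''' = (max(min(t_i, K), −K))_{i∈ℤ/nℤ} also satisfy (A), and Σ(T') = Σ(T'') = Σ(T''') = Σ(T). (Lemma 5.2.)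 -/
open Set Filter Metric Topology

noncomputable section

/-- A continuous logarithm along one edge of the square is a principal logarithm. -/
theorem edge_log (l g : ℝ → ℂ) (hl : Continuous l) (hg : Continuous g) (θ : ℝ) (k : ℂ)
    (hk : k ≠ 0) (hg1 : ∀ s, ‖g s‖ ≤ 1) (hne : ∀ s, g s ≠ Complex.exp (θ * Complex.I))
    (he : ∀ s, Complex.exp (l s) = k * (1 - g s * Complex.exp (-(θ * Complex.I)))) (u v : ℝ) :
    l v - l u = Complex.log (1 - g v * Complex.exp (-(θ * Complex.I))) -
      Complex.log (1 - g u * Complex.exp (-(θ * Complex.I))) := by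
  set f : ℝ → ℂ := fun s => 1 - g s * Complex.exp (-(θ * Complex.I)) with hf
  have hfc : Continuous f := by fun_prop
  have hslit : ∀ s, f s ∈ Complex.slitPlane := by
    intro s
    left
    set w := g s * Complex.exp (-(θ * Complex.I)) with hw
    have hw1 : ‖w‖ ≤ 1 := by
      have : ‖Complex.exp (-(θ * Complex.I))‖ = 1 := by
        have := Complex.norm_exp_ofReal_mul_I (-θ)
        simpa using this
      rw [hw, norm_mul, this, mul_one]; exact hg1 s
    have hwne : w ≠ 1 := by
      intro h
      apply hne s
      have : g s = w * Complex.exp (θ * Complex.I) := by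
        rw [hw, mul_assoc, ← Complex.exp_add]; simp
      rw [this, h, one_mul]
    have h2 : w.re * w.re + w.im * w.im ≤ 1 := by
      have := Complex.sq_norm w
      rw [Complex.normSq_apply] at this
      rw [← this]; nlinarith [norm_nonneg w]
    have : w.re < 1 := by
      by_contra hcon
      push Not at hcon
      have hre : w.re = 1 := by nlinarith [mul_self_nonneg w.im]
      have him : w.im = 0 := by
        have : w.im * w.im ≤ 0 := by rw [hre] at h2; linarith
        exact mul_self_eq_zero.mp (le_antisymm this (mul_self_nonneg _))
      exact hwne (Complex.ext (by simpa using hre) (by simpa using him))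
    show 0 < (1 - w).re
    simp; exact this
  have hlog : Continuous fun s => Complex.log (f s) := hfc.clog hslit
  have hexp : ∀ s, Complex.exp (l s - Complex.log (f s)) = k := by
    intro s
    have h0 : f s ≠ 0 := Complex.slitPlane_ne_zero (hslit s)
    rw [Complex.exp_sub, Complex.exp_log h0, he s]
    exact mul_div_cancel_right₀ k h0
  have hc := Complex.isCoveringMap_exp.const_of_comp (g := fun s => l s - Complex.log (f s))
    (hl.sub hlog) (fun a a' => Subtype.ext ((hexp a).trans (hexp a').symm)) v u
  have hc' : l v - Complex.log (f v) = l u - Complex.log (f u) := hc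
  show l v - l u = Complex.log (f v) - Complex.log (f u)
  linear_combination hc'

theorem arg_aux (θ : ℝ) (h0 : 0 < θ) (h1 : θ < 2 * Real.pi) :
    Complex.arg (1 - Complex.exp (θ * Complex.I)) = (θ - Real.pi) / 2 := by
  have hs : 0 < 2 * Real.sin (θ / 2) := by
    have := Real.sin_pos_of_pos_of_lt_pi (x := θ / 2) (by linarith) (by linarith)
    linarith
  have key := Complex.arg_mul_cos_add_sin_mul_I hs (θ := (θ - Real.pi) / 2)
    ⟨by linarith [Real.pi_pos], by linarith [Real.pi_pos]⟩
  rw [← key]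
  congr 1
  have e1 : Real.cos ((θ - Real.pi) / 2) = Real.sin (θ / 2) := by
    rw [show (θ - Real.pi) / 2 = -(Real.pi / 2 - θ / 2) by ring, Real.cos_neg,
      Real.cos_pi_div_two_sub]
  have e2 : Real.sin ((θ - Real.pi) / 2) = - Real.cos (θ / 2) := by
    rw [show (θ - Real.pi) / 2 = -(Real.pi / 2 - θ / 2) by ring, Real.sin_neg,
      Real.sin_pi_div_two_sub]
  rw [← Complex.ofReal_cos, ← Complex.ofReal_sin, e1, e2, Complex.exp_mul_I,
    ← Complex.ofReal_cos, ← Complex.ofReal_sin]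
  have e3 : Real.cos θ = 1 - 2 * Real.sin (θ / 2) ^ 2 := by
    have := Real.cos_sq' (θ / 2)
    have h := Real.cos_two_mul (θ / 2)
    rw [show 2 * (θ / 2) = θ by ring] at h
    rw [h, this]; ring
  have e4 : Real.sin θ = 2 * Real.sin (θ / 2) * Real.cos (θ / 2) := by
    have h := Real.sin_two_mul (θ / 2)
    rwa [show 2 * (θ / 2) = θ by ring] at h
  rw [e3, e4]
  push_cast
  ring

theorem arg_sub (x y : ℝ) (h0 : y < x) (h1 : x < y + 2 * Real.pi) :
    (Complex.log (1 - Complex.exp (x * Complex.I) * Complex.exp (-(y * Complex.I)))).im =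
      (x - y - Real.pi) / 2 := by
  rw [Complex.log_im, ← Complex.exp_add, ← arg_aux (x - y) (by linarith) (by linarith)]
  congr 3
  push_cast; ring

theorem arg_sub' (x y : ℝ) (h0 : y < x) (h1 : x < y + 2 * Real.pi) :
    (Complex.log (1 - Complex.exp (y * Complex.I) * Complex.exp (-(x * Complex.I)))).im =
      -((x - y - Real.pi) / 2) := by
  have := arg_sub (y + 2 * Real.pi) x (by linarith) (by linarith)
  have e : Complex.exp (((y + 2 * Real.pi : ℝ) : ℂ) * Complex.I) =
      Complex.exp (y * Complex.I) := by
    push_cast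
    rw [add_mul, Complex.exp_add, Complex.exp_two_pi_mul_I, mul_one]
  rw [e] at this
  rw [this]; ring

/-- Two paths in the closed disk with interlaced end points on the circle meet. -/
theorem crossing_closed (g d : ℝ → ℂ) (hg : Continuous g) (hd : Continuous d)
    (hg1 : ∀ s, ‖g s‖ ≤ 1) (hd1 : ∀ s, ‖d s‖ ≤ 1) (hne : ∀ s t, g s ≠ d t)
    (u v a b c e : ℝ) (hac : a < c) (hcb : c < b) (hbe : b < e) (hea : e < a + 2 * Real.pi)
    (ga : g u = Complex.exp (a * Complex.I)) (gb : g v = Complex.exp (b * Complex.I))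
    (dc : d u = Complex.exp (c * Complex.I)) (de : d v = Complex.exp (e * Complex.I)) :
    False := by
  obtain ⟨L, ⟨-, hL⟩, -⟩ := Complex.isCoveringMapOn_exp.existsUnique_continuousMap_lifts
    (A := ℝ × ℝ) ⟨fun p => g p.1 - d p.2, by fun_prop⟩ (a₀ := (0, 0))
    (e₀ := Complex.log (g 0 - d 0)) (Complex.exp_log (sub_ne_zero.mpr (hne 0 0)))
    (fun p => sub_ne_zero.mpr (hne p.1 p.2))
  have hL' : ∀ s t, Complex.exp (L (s, t)) = g s - d t := fun s t => congrFun hL (s, t)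
  have hinv : ∀ x : ℝ, Complex.exp (x * Complex.I) * Complex.exp (-(x * Complex.I)) = 1 := by
    intro x; rw [← Complex.exp_add]; simp
  have H1 : ∀ t₀ y : ℝ, d t₀ = Complex.exp (y * Complex.I) →
      L (v, t₀) - L (u, t₀) = Complex.log (1 - g v * Complex.exp (-(y * Complex.I))) -
      Complex.log (1 - g u * Complex.exp (-(y * Complex.I))) := by
    intro t₀ y hy
    refine edge_log (fun s => L (s, t₀)) g (by fun_prop) hg y (-Complex.exp (y * Complex.I))
      (neg_ne_zero.mpr (Complex.exp_ne_zero _)) hg1 (fun s => hy ▸ hne s t₀) ?_ u v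
    intro s
    rw [hL', hy]
    linear_combination (- g s) * hinv y
  have H2 : ∀ s₀ y : ℝ, g s₀ = Complex.exp (y * Complex.I) →
      L (s₀, v) - L (s₀, u) = Complex.log (1 - d v * Complex.exp (-(y * Complex.I))) -
      Complex.log (1 - d u * Complex.exp (-(y * Complex.I))) := by
    intro s₀ y hy
    refine edge_log (fun s => L (s₀, s)) d (by fun_prop) hd y (Complex.exp (y * Complex.I))
      (Complex.exp_ne_zero _) hd1 (fun s => hy ▸ (hne s₀ s).symm) ?_ u v
    intro s
    rw [hL', hy]
    linear_combination (d s) * hinv y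
  have A1 := congrArg Complex.im (H1 u c dc)
  have A2 := congrArg Complex.im (H1 v e de)
  have A3 := congrArg Complex.im (H2 u a ga)
  have A4 := congrArg Complex.im (H2 v b gb)
  rw [ga, gb] at A1 A2
  rw [dc, de] at A3 A4
  simp only [Complex.sub_im] at A1 A2 A3 A4
  rw [arg_sub b c hcb (by linarith), arg_sub' c a hac (by linarith)] at A1
  rw [arg_sub' e b hbe (by linarith), arg_sub' e a (by linarith) (by linarith)] at A2
  rw [arg_sub e a (by linarith) (by linarith), arg_sub c a (by linarith) (by linarith)] at A3
  rw [arg_sub e b hbe (by linarith), arg_sub' b c hcb (by linarith)] at A4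
  linarith [Real.pi_pos]

/-- Compactify a path having limits at both ends. -/
theorem compactify (γ : ℝ → ℂ) (hγ : Continuous γ) (a b : ℂ)
    (ha : Tendsto γ atBot (𝓝 a)) (hb : Tendsto γ atTop (𝓝 b)) :
    ∃ g : ℝ → ℂ, Continuous g ∧ g (-(Real.pi / 2)) = a ∧ g (Real.pi / 2) = b ∧
      ∀ x, g x = a ∨ g x = b ∨ ∃ s, g x = γ s := by
  have hlt : -(Real.pi / 2) < Real.pi / 2 := by linarith [Real.pi_pos]
  set f : ℝ → ℂ := fun x => γ (Real.tan x) with hf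
  have hfc : ContinuousOn f (Ioo (-(Real.pi / 2)) (Real.pi / 2)) :=
    hγ.comp_continuousOn Real.continuousOn_tan_Ioo
  have hfa : Tendsto f (𝓝[>] (-(Real.pi / 2))) (𝓝 a) := ha.comp Real.tendsto_tan_neg_pi_div_two
  have hfb : Tendsto f (𝓝[<] (Real.pi / 2)) (𝓝 b) := hb.comp Real.tendsto_tan_pi_div_two
  set F := extendFrom (Ioo (-(Real.pi / 2)) (Real.pi / 2)) f with hF
  have hFc : ContinuousOn F (Icc (-(Real.pi / 2)) (Real.pi / 2)) :=
    continuousOn_Icc_extendFrom_Ioo hfc hfa hfb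
  have Fa : F (-(Real.pi / 2)) = a := eq_lim_at_left_extendFrom_Ioo hlt hfa
  have Fb : F (Real.pi / 2) = b := eq_lim_at_right_extendFrom_Ioo hlt hfb
  refine ⟨IccExtend hlt.le (Set.domRestrict _ F), ?_, ?_, ?_, ?_⟩
  · exact (continuousOn_iff_continuous_domRestrict.mp hFc).Icc_extend'
  · simp [Fa]
  · simp [Fb]
  · intro x
    obtain ⟨y, hy⟩ : ∃ y : Icc (-(Real.pi / 2)) (Real.pi / 2), y = projIcc _ _ hlt.le x :=
      ⟨_, rfl⟩
    have : IccExtend hlt.le (Set.domRestrict _ F) x = F y.1 := by rw [hy]; rfl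
    rw [this]
    rcases eq_or_lt_of_le y.2.1 with h | h
    · left; rw [← h, Fa]
    rcases eq_or_lt_of_le y.2.2 with h' | h'
    · right; left; rw [h', Fb]
    · right; right
      refine ⟨Real.tan y.1, ?_⟩
      exact extendFrom_eq (by rw [closure_Ioo hlt.ne]; exact y.2) (hfc y.1 ⟨h, h'⟩)

theorem crossing_open (γ δ : ℝ → ℂ) (hγ : Continuous γ) (hδ : Continuous δ)
    (hγ1 : ∀ s, ‖γ s‖ < 1) (hδ1 : ∀ s, ‖δ s‖ < 1) (hne : ∀ s t, γ s ≠ δ t)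
    (p q r w : ℂ) (hp : Tendsto γ atBot (𝓝 p)) (hq : Tendsto γ atTop (𝓝 q))
    (hr : Tendsto δ atBot (𝓝 r)) (hw : Tendsto δ atTop (𝓝 w))
    (hpr : p ≠ r) (hpw : p ≠ w) (hqr : q ≠ r) (hqw : q ≠ w)
    (a b c e : ℝ) (hac : a < c) (hcb : c < b) (hbe : b < e) (hea : e < a + 2 * Real.pi)
    (ga : p = Complex.exp (a * Complex.I)) (gb : q = Complex.exp (b * Complex.I))
    (dc : r = Complex.exp (c * Complex.I)) (de : w = Complex.exp (e * Complex.I)) :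
    False := by
  obtain ⟨g, hg, g1, g2, g3⟩ := compactify γ hγ p q hp hq
  obtain ⟨d, hd, d1, d2, d3⟩ := compactify δ hδ r w hr hw
  have np : ‖p‖ = 1 := by rw [ga]; exact Complex.norm_exp_ofReal_mul_I a
  have nq : ‖q‖ = 1 := by rw [gb]; exact Complex.norm_exp_ofReal_mul_I b
  have nr : ‖r‖ = 1 := by rw [dc]; exact Complex.norm_exp_ofReal_mul_I c
  have nw : ‖w‖ = 1 := by rw [de]; exact Complex.norm_exp_ofReal_mul_I e
  refine crossing_closed g d hg hd ?_ ?_ ?_ (-(Real.pi / 2)) (Real.pi / 2) a b c e hac hcb hbe hea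
    (g1.trans ga) (g2.trans gb) (d1.trans dc) (d2.trans de)
  · intro s
    rcases g3 s with h | h | ⟨x, h⟩ <;> rw [h]
    · exact np.le
    · exact nq.le
    · exact (hγ1 x).le
  · intro s
    rcases d3 s with h | h | ⟨x, h⟩ <;> rw [h]
    · exact nr.le
    · exact nw.le
    · exact (hδ1 x).le
  · intro s t
    rcases g3 s with h | h | ⟨x, h⟩ <;> rcases d3 t with h' | h' | ⟨y, h'⟩ <;> rw [h, h']
    · exact hpr
    · exact hpw
    · intro hh; have := hδ1 y; rw [← hh, np] at this; exact lt_irrefl _ this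
    · exact hqr
    · exact hqw
    · intro hh; have := hδ1 y; rw [← hh, nq] at this; exact lt_irrefl _ this
    · intro hh; have := hγ1 x; rw [hh, nr] at this; exact lt_irrefl _ this
    · intro hh; have := hγ1 x; rw [hh, nw] at this; exact lt_irrefl _ this
    · exact hne x y

theorem exp_shift (x : ℝ) (m : ℤ) :
    Complex.exp (((x + m * (2 * Real.pi) : ℝ) : ℂ) * Complex.I) = Complex.exp (x * Complex.I) := by
  have : (((x + m * (2 * Real.pi) : ℝ) : ℂ) * Complex.I) =
      x * Complex.I + m * (2 * Real.pi * Complex.I) := by push_cast; ring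
  rw [this, Complex.exp_add, Complex.exp_int_mul_two_pi_mul_I, mul_one]

theorem exp_eq_shift (x y : ℝ) (h : Complex.exp (x * Complex.I) = Complex.exp (y * Complex.I)) :
    ∃ m : ℤ, x = y + m * (2 * Real.pi) := by
  obtain ⟨m, hm⟩ := Complex.exp_eq_exp_iff_exists_int.mp h
  refine ⟨m, ?_⟩
  have := congrArg Complex.im hm
  simpa using this

/-- Representatives of angles in a prescribed half-open interval. -/
theorem exists_angle (z : ℂ) (hz : z ∈ Metric.sphere (0 : ℂ) 1) (P : ℝ) :
    ∃ x : ℝ, P ≤ x ∧ x < P + 2 * Real.pi ∧ z = Complex.exp (x * Complex.I) := by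
  have hz1 : ‖z‖ = 1 := by simpa using hz
  have h := toIcoMod_mem_Ico Real.two_pi_pos P z.arg
  refine ⟨toIcoMod Real.two_pi_pos P z.arg, h.1, h.2, ?_⟩
  have h1 : toIcoMod Real.two_pi_pos P z.arg =
      z.arg + ((-toIcoDiv Real.two_pi_pos P z.arg : ℤ) : ℝ) * (2 * Real.pi) := by
    have h2 := self_sub_toIcoDiv_zsmul Real.two_pi_pos P z.arg
    rw [← h2, zsmul_eq_mul]; push_cast; ring
  rw [h1, exp_shift]
  have := Complex.norm_mul_exp_arg_mul_I z
  rw [hz1] at this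
  simpa using this.symm

/-- The combinatorial consequence of the cyclic order hypotheses. -/
theorem angles (n : ℕ) (Γ : ZMod n → ℝ → ↥Disk) (α ω : ZMod n → ℂ)
    (hG : SettingG n Γ α ω) (i j : ZMod n) (h1 : j ≠ i - 1) (h2 : j ≠ i) (h3 : i - 1 ≠ i) :
    ∃ a b c e : ℝ, a < c ∧ c < b ∧ b < e ∧ e < a + 2 * Real.pi ∧
      α (i - 1) = Complex.exp (a * Complex.I) ∧ ω (i - 1) = Complex.exp (b * Complex.I) ∧
      α i = Complex.exp (c * Complex.I) ∧ α j = Complex.exp (e * Complex.I) := by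
  have m1 := hG.arcMem (i - 1)
  rw [sub_add_cancel] at m1
  have m2 := hG.arcMem (i - 1 - 1)
  rw [sub_add_cancel] at m2
  have o1 : ∀ k, InCcwArc (ω (i - 1 - 1)) (ω (i - 1)) (α k) → k = i := by
    intro k hk; simpa using hG.arcOnlyα (i - 1) k hk
  have o2 : ∀ k, InCcwArc (ω (i - 1 - 1 - 1)) (ω (i - 1 - 1)) (α k) → k = i - 1 := by
    intro k hk; simpa using hG.arcOnlyα (i - 1 - 1) k hk
  obtain ⟨P, C, Q, hPC, hCQ, hQP, eP, eC, eQ⟩ := m1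
  have loc : ∀ k, k ≠ i → ∃ x : ℝ, Q < x ∧ x < P + 2 * Real.pi ∧
      α k = Complex.exp (x * Complex.I) := by
    intro k hk
    obtain ⟨x, hx1, hx2, hx3⟩ := exists_angle (α k) (hG.αmem k) P
    refine ⟨x, ?_, hx2, hx3⟩
    by_contra hcon
    push Not at hcon
    have n1 : x ≠ P := fun h => hG.αω k (i - 1 - 1) (by rw [hx3, eP, h])
    have n2 : x ≠ Q := fun h => hG.αω k (i - 1) (by rw [hx3, eQ, h])
    exact hk (o1 k ⟨P, x, Q, lt_of_le_of_ne hx1 n1.symm, lt_of_le_of_ne hcon n2, hQP, eP, hx3, eQ⟩)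
  obtain ⟨A, hA1, hA2, hA3⟩ := loc (i - 1) h3
  obtain ⟨B, hB1, hB2, hB3⟩ := loc j h2
  have hBA : B < A := by
    by_contra hcon
    push Not at hcon
    have hne : A ≠ B := fun h => h1 (hG.αinj (by rw [hA3, hB3, h]))
    have hAB : A < B := lt_of_le_of_ne hcon hne
    obtain ⟨R, A', P', q1, q2, q3, eR, eA', eP'⟩ := m2
    obtain ⟨m, hm⟩ := exp_eq_shift P' P (eP'.symm.trans eP)
    obtain ⟨k, hk⟩ := exp_eq_shift A' A (eA'.symm.trans hA3)
    have hpi := Real.pi_pos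
    have hkm : k = m - 1 := by
      have l1 : (k : ℝ) < m := by
        by_contra hc; push Not at hc
        nlinarith
      have l2 : (m : ℝ) - 2 < k := by
        by_contra hc; push Not at hc
        nlinarith
      have l1' : k < m := by exact_mod_cast l1
      have l2' : m - 2 < k := by exact_mod_cast l2
      omega
    have hkm' : (k : ℝ) = m - 1 := by rw [hkm]; push_cast; ring
    apply h1
    apply o2 j
    refine ⟨R, B + k * (2 * Real.pi), P', ?_, ?_, q3, eR, ?_, eP'⟩
    · linarith
    · rw [hm, hkm']; linarith
    · rw [exp_shift, hB3]
  refine ⟨A - 2 * Real.pi, Q, C, B, by linarith, hCQ, hB1, by linarith, ?_, eQ, eC, hB3⟩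
  rw [hA3, ← exp_shift A (-1)]
  congr 3
  push_cast; ring

/-- Lemma 5.2. -/
theorem handel_lem_5_2 (n : ℕ) (Γ : ZMod n → ℝ → ↥Disk) (α ω : ZMod n → ℂ)
    (hG : SettingG n Γ α ω) (K : ℝ) (hK : 0 < K)
    (hKbot : ∀ i i', i ≠ i' → (Γ i '' Set.Iic (-K)) ∩ Set.range (Γ i') = ∅)
    (hKtop : ∀ i i', i ≠ i' → (Γ i '' Set.Ici K) ∩ Set.range (Γ i') = ∅)
    (t : ZMod n → ℝ) (hA : CondA n Γ t) :
    (∀ i ∈ SigmaSet n Γ t, -K < t i ∧ t (i - 1) < K) ∧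
    (CondA n Γ (fun i => min (t i) K) ∧
      SigmaSet n Γ (fun i => min (t i) K) = SigmaSet n Γ t) ∧
    (CondA n Γ (fun i => max (t i) (-K)) ∧
      SigmaSet n Γ (fun i => max (t i) (-K)) = SigmaSet n Γ t) ∧
    (CondA n Γ (fun i => max (min (t i) K) (-K)) ∧
      SigmaSet n Γ (fun i => max (min (t i) K) (-K)) = SigmaSet n Γ t) := by
  have hpar : ∀ i j, i ≠ j → ∀ s s', Γ i s = Γ j s' → -K < s ∧ s < K := by
    intro i j hij s s' h
    constructor
    · by_contra hc
      push Not at hc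
      have : Γ i s ∈ (Γ i '' Set.Iic (-K)) ∩ Set.range (Γ j) := ⟨⟨s, hc, rfl⟩, ⟨s', h.symm⟩⟩
      rw [hKbot i j hij] at this
      exact this
    · by_contra hc
      push Not at hc
      have : Γ i s ∈ (Γ i '' Set.Ici K) ∩ Set.range (Γ j) := ⟨⟨s, hc, rfl⟩, ⟨s', h.symm⟩⟩
      rw [hKtop i j hij] at this
      exact this
  have hAiff : ∀ t : ZMod n → ℝ, CondA n Γ t ↔
      ∀ i j, i ≠ j → ∀ s s', Γ i s = Γ j s' → s < t i → s' < t j → False := by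
    intro t
    constructor
    · intro h i j hij s s' he hs hs'
      exact Set.disjoint_left.mp (h hij) ⟨s, hs, rfl⟩ ⟨s', hs', he.symm⟩
    · intro h i j hij
      refine Set.disjoint_left.mpr ?_
      rintro x ⟨s, hs, rfl⟩ ⟨s', hs', he⟩
      exact h i j hij s s' he.symm hs hs'
  have hSiff : ∀ (t : ZMod n → ℝ) (i : ZMod n), i ∈ SigmaSet n Γ t ↔
      ∃ j, j ≠ i - 1 ∧ j ≠ i ∧ ∃ s s', Γ i s = Γ j s' ∧ s ≤ t i ∧ s' ≤ t j := by
    intro t i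
    constructor
    · rintro ⟨j, h1, h2, x, ⟨s, hs, rfl⟩, ⟨s', hs', he⟩⟩
      exact ⟨j, h1, h2, s, s', he.symm, hs, hs'⟩
    · rintro ⟨j, h1, h2, s, s', he, hs, hs'⟩
      exact ⟨j, h1, h2, Γ i s, ⟨s, hs, rfl⟩, ⟨s', hs', he.symm⟩⟩
  have hgen : ∀ t' : ZMod n → ℝ,
      (∀ i s, -K < s → s < K → ((s < t' i → s < t i) ∧ (s ≤ t' i ↔ s ≤ t i))) →
      CondA n Γ t' ∧ SigmaSet n Γ t' = SigmaSet n Γ t := by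
    intro t' h
    constructor
    · rw [hAiff]
      intro i j hij s s' he hs hs'
      obtain ⟨a1, a2⟩ := hpar i j hij s s' he
      obtain ⟨b1, b2⟩ := hpar j i hij.symm s' s he.symm
      exact (hAiff t).mp hA i j hij s s' he ((h i s a1 a2).1 hs) ((h j s' b1 b2).1 hs')
    · ext i
      rw [hSiff, hSiff]
      refine exists_congr fun j => and_congr_right fun _ => and_congr_right fun hj =>
        exists_congr fun s => exists_congr fun s' => and_congr_right fun he => ?_
      obtain ⟨a1, a2⟩ := hpar i j hj.symm s s' he
      obtain ⟨b1, b2⟩ := hpar j i hj s' s he.symm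
      exact and_congr (h i s a1 a2).2 (h j s' b1 b2).2
  refine ⟨?_, hgen _ ?_, hgen _ ?_, hgen _ ?_⟩
  · intro i hi
    obtain ⟨j, hj1, hj2, s, s', he, hs, hs'⟩ := (hSiff t i).mp hi
    have hp := hpar i j hj2.symm s s' he
    refine ⟨lt_of_lt_of_le hp.1 hs, ?_⟩
    by_contra hcon
    push Not at hcon
    have hii : i - 1 ≠ i := by
      intro h
      have h10 : (1 : ZMod n) = 0 := by simpa using h
      have hn := hG.hn
      have : Fact (1 < n) := ⟨by omega⟩
      exact one_ne_zero h10
    obtain ⟨a, b, c, e, r1, r2, r3, r4, ea, eb, ec, ee⟩ := angles n Γ α ω hG i j hj1 hj2 hii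
    -- no point of the initial pieces lies on the curve `Γ (i - 1)`
    have hfree : ∀ k l, k ≠ i - 1 → l ≠ i - 1 → k ≠ l → ∀ x x', x ≤ t k → Γ k x = Γ l x' →
        ∀ y ≤ x, ∀ z, Γ (i - 1) z ≠ Γ k y := by
      intro k l hk hl hkl x x' hx hx' y hy z hz
      have hz2 := (hpar (i - 1) k hk.symm z y hz).2
      rcases lt_or_eq_of_le hy with hlt | heq
      · exact (hAiff t).mp hA (i - 1) k hk.symm z y hz (by linarith) (by linarith)
      · subst heq
        have : Γ k y ∈ Set.range (Γ k) ∩ Set.range (Γ l) ∩ Set.range (Γ (i - 1)) :=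
          ⟨⟨⟨y, rfl⟩, ⟨x', hx'.symm⟩⟩, ⟨z, hz⟩⟩
        rw [hG.noTripleCurve k l (i - 1) hkl hk hl] at this
        exact this
    have f1 := hfree i j hii.symm hj1 hj2.symm s s' hs he
    have f2 := hfree j i hj1 hii.symm hj2 s' s hs' he.symm
    have hnorm : ∀ k x, ‖(Γ k x).1‖ < 1 := fun k x => mem_ball_zero_iff.mp (Γ k x).2
    have hcv : ∀ k, Continuous fun x => (Γ k x).1 := fun k =>
      continuous_subtype_val.comp (hG.cont k)
    refine crossing_open (fun x => (Γ (i - 1) x).1)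
      (fun x => if x ≤ 0 then (Γ i (s + x)).1 else (Γ j (s' - x)).1) (hcv _) ?_ (hnorm _) ?_ ?_
      (α (i - 1)) (ω (i - 1)) (α i) (α j) (hG.limBot _) (hG.limTop _) ?_ ?_
      (fun h => hii (hG.αinj h)) (fun h => hj1 (hG.αinj h).symm) (hG.αω _ _).symm
      (hG.αω _ _).symm a b c e r1 r2 r3 r4 ea eb ec ee
    · refine Continuous.if_le ((hcv i).comp (by fun_prop)) ((hcv j).comp (by fun_prop))
        continuous_id continuous_const ?_
      intro x hx
      have hx0 : x = 0 := hx
      subst hx0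
      simp [he]
    · intro x
      split_ifs
      · exact hnorm _ _
      · exact hnorm _ _
    · intro z x hzx
      split_ifs at hzx with hx
      · exact f1 (s + x) (by linarith) z (Subtype.ext hzx)
      · exact f2 (s' - x) (by linarith) z (Subtype.ext hzx)
    · have h1 : Tendsto (fun x : ℝ => s + x) atBot atBot :=
        tendsto_atBot_add_const_left _ _ tendsto_id
      refine ((hG.limBot i).comp h1).congr' ?_
      filter_upwards [eventually_le_atBot (0 : ℝ)] with x hx
      simp [hx]
    · have h1 : Tendsto (fun x : ℝ => s' - x) atTop atBot := by
        simpa [sub_eq_add_neg] using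
          tendsto_atBot_add_const_left atTop s' tendsto_neg_atTop_atBot
      refine ((hG.limBot j).comp h1).congr' ?_
      filter_upwards [eventually_gt_atTop (0 : ℝ)] with x hx
      simp [not_le.mpr hx]
  · intro i s h1 h2
    simp only [lt_min_iff, le_min_iff]
    exact ⟨fun h => h.1, fun h => h.1, fun h => ⟨h, h2.le⟩⟩
  · intro i s h1 h2
    simp only [lt_max_iff, le_max_iff]
    exact ⟨fun h => h.elim id (fun h => by linarith),
      fun h => h.elim id (fun h => by linarith), fun h => Or.inl h⟩
  · intro i s h1 h2
    simp only [lt_max_iff, le_max_iff, lt_min_iff, le_min_iff]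
    exact ⟨fun h => h.elim (fun h => h.1) (fun h => by linarith),
      fun h => h.elim (fun h => h.1) (fun h => by linarith), fun h => Or.inl ⟨h, h2.le⟩⟩
end
end

section
/- Under Setting (G), there exists a configuration T = (t_i)_{i∈ℤ/nℤ} satisfying (A) whose order is at least n−1, i.e. such that Σ(T) has at least n−1 elements. (Lemma 5.3.) -/
open Set Filter Metric Topology

noncomputable section

theorem exp_lift_const (k : ℝ → ℂ) (hk : Continuous k) (u : ℂ)
    (h : ∀ t, Complex.exp (k t) = u) (s t : ℝ) : k s = k t := by
  refine Complex.isCoveringMap_exp.const_of_comp hk ?_ s t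
  intro a b
  simp [h]

theorem edge_aux (L w : ℝ → ℂ) (hL : Continuous L) (hw : Continuous w) (u : ℂ)
    (hw1 : ∀ t, ‖w t‖ ≤ 1) (h : ∀ t, Complex.exp (L t) = u * (1 - w t)) (s t : ℝ) :
    L s - L t = Complex.log (1 - w s) - Complex.log (1 - w t) := by
  have hne : ∀ t, 1 - w t ≠ 0 := fun t h0 => Complex.exp_ne_zero (L t) (by rw [h, h0, mul_zero])
  have hsl : ∀ t, 1 - w t ∈ Complex.slitPlane := by
    intro t
    rw [Complex.mem_slitPlane_iff]
    by_contra hcon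
    push Not at hcon
    obtain ⟨h1, h2⟩ := hcon
    have h3 : (w t).re ≤ 1 := (Complex.re_le_norm _).trans (hw1 t)
    simp only [Complex.sub_re, Complex.one_re] at h1
    apply hne t
    apply Complex.ext
    · simp; linarith
    · simpa using h2
  have hc : Continuous fun t => L t - Complex.log (1 - w t) :=
    hL.sub (Continuous.clog (continuous_const.sub hw) hsl)
  have := exp_lift_const _ hc u (fun t => by
    rw [Complex.exp_sub, Complex.exp_log (hne t), h, mul_div_cancel_right₀ _ (hne t)]) s t

  linear_combination this

theorem log_im_pos (θ : ℝ) (h0 : 0 < θ) (h1 : θ < 2 * Real.pi) :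
    (Complex.log (1 - Complex.exp (θ * Complex.I))).im = (θ - Real.pi) / 2 := by
  have key : 1 - Complex.exp (θ * Complex.I) = ((2 * Real.sin (θ / 2) : ℝ) : ℂ) *
      (Complex.cos (((θ - Real.pi) / 2 : ℝ)) + Complex.sin (((θ - Real.pi) / 2 : ℝ)) * Complex.I) := by
    have e1 : (θ - Real.pi) / 2 = θ / 2 - Real.pi / 2 := by ring
    have e2 : θ = 2 * (θ / 2) := by ring
    rw [e1, ← Complex.ofReal_cos, ← Complex.ofReal_sin, Real.cos_sub_pi_div_two, Real.sin_sub_pi_div_two,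
      Complex.exp_mul_I, ← Complex.ofReal_cos, ← Complex.ofReal_sin]
    nth_rewrite 1 [e2]
    nth_rewrite 2 [e2]
    rw [Real.cos_two_mul, Real.sin_two_mul]
    have := Real.sin_sq_add_cos_sq (θ / 2)
    apply Complex.ext
    · simp [-Complex.ofReal_sin, -Complex.ofReal_cos, ← Complex.ofReal_pow, -Complex.ofReal_div]; nlinarith
    · simp [-Complex.ofReal_sin, -Complex.ofReal_cos, ← Complex.ofReal_pow, -Complex.ofReal_div]
  rw [Complex.log_im, key]
  apply Complex.arg_mul_cos_add_sin_mul_I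
  · have := Real.sin_pos_of_pos_of_lt_pi (x := θ / 2) (by linarith) (by linarith)
    linarith
  · constructor <;> linarith

theorem log_im_neg (θ : ℝ) (h0 : -(2 * Real.pi) < θ) (h1 : θ < 0) :
    (Complex.log (1 - Complex.exp (θ * Complex.I))).im = (θ + Real.pi) / 2 := by
  have key : 1 - Complex.exp (θ * Complex.I) = ((2 * Real.sin (-θ / 2) : ℝ) : ℂ) *
      (Complex.cos (((θ + Real.pi) / 2 : ℝ)) + Complex.sin (((θ + Real.pi) / 2 : ℝ)) * Complex.I) := by
    have e1 : (θ + Real.pi) / 2 = θ / 2 + Real.pi / 2 := by ring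
    have e2 : θ = 2 * (θ / 2) := by ring
    rw [e1, ← Complex.ofReal_cos, ← Complex.ofReal_sin, Real.cos_add_pi_div_two, Real.sin_add_pi_div_two,
      Complex.exp_mul_I, ← Complex.ofReal_cos, ← Complex.ofReal_sin, neg_div, Real.sin_neg]
    nth_rewrite 1 [e2]
    nth_rewrite 2 [e2]
    rw [Real.cos_two_mul, Real.sin_two_mul]
    have := Real.sin_sq_add_cos_sq (θ / 2)
    apply Complex.ext
    · simp [-Complex.ofReal_sin, -Complex.ofReal_cos, ← Complex.ofReal_pow, -Complex.ofReal_div]; nlinarith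
    · simp [-Complex.ofReal_sin, -Complex.ofReal_cos, ← Complex.ofReal_pow, -Complex.ofReal_div]
  rw [Complex.log_im, key]
  apply Complex.arg_mul_cos_add_sin_mul_I
  · have := Real.sin_pos_of_pos_of_lt_pi (x := -θ / 2) (by linarith) (by linarith)
    linarith
  · constructor <;> linarith

/-- The circle point of angle `x`. -/
noncomputable def cpt (x : ℝ) : ℂ := Complex.exp (x * Complex.I)

theorem cpt_ne (x : ℝ) : cpt x ≠ 0 := Complex.exp_ne_zero _

theorem cpt_norm (x : ℝ) : ‖cpt x‖ = 1 := Complex.norm_exp_ofReal_mul_I x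

theorem cpt_div (x y : ℝ) : cpt x / cpt y = Complex.exp (((x - y : ℝ) : ℂ) * Complex.I) := by
  rw [cpt, cpt, ← Complex.exp_sub]; congr 1; push_cast; ring

theorem crossing (γ δ : ℝ → ℂ) (hγ : Continuous γ) (hδ : Continuous δ)
    (hγ1 : ∀ t, ‖γ t‖ ≤ 1) (hδ1 : ∀ t, ‖δ t‖ ≤ 1) (A C B D : ℝ)
    (hAC : A < C) (hCB : C < B) (hBD : B < D) (hDA : D < A + 2 * Real.pi)
    (ga : γ 0 = cpt A) (gb : γ 1 = cpt B) (dc : δ 0 = cpt C) (dd : δ 1 = cpt D) :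
    ∃ s t, γ s = δ t := by
  by_contra! hne
  have hFc : Continuous fun p : ℝ × ℝ => γ p.1 - δ p.2 := by fun_prop
  obtain ⟨L, hLF⟩ : ∃ L : C(ℝ × ℝ, ℂ), ∀ p, Complex.exp (L p) = γ p.1 - δ p.2 := by
    have h0 : γ 0 - δ 0 ≠ 0 := sub_ne_zero.2 (hne 0 0)
    obtain ⟨L, ⟨-, hL⟩, -⟩ := Complex.isCoveringMapOn_exp.existsUnique_continuousMap_lifts
      (⟨_, hFc⟩ : C(ℝ × ℝ, ℂ)) (a₀ := (0, 0)) (e₀ := Complex.log (γ 0 - δ 0))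
      (by simp [Complex.exp_log h0]) (by intro p; simpa using sub_ne_zero.2 (hne _ _))
    exact ⟨L, fun p => congrFun hL p⟩
  have n1 : ∀ (f : ℝ → ℂ), (∀ t, ‖f t‖ ≤ 1) → ∀ x t, ‖f t / cpt x‖ ≤ 1 := by
    intro f hf x t; rw [norm_div, cpt_norm, div_one]; exact hf t
  have E1 := edge_aux (fun t => L (0, t)) (fun t => δ t / cpt A) (by fun_prop) (by fun_prop) (cpt A)
    (n1 _ hδ1 A) (fun t => by rw [hLF]; simp only [ga]; field_simp [cpt_ne A]) 1 0
  have E2 := edge_aux (fun t => L (1, t)) (fun t => δ t / cpt B) (by fun_prop) (by fun_prop) (cpt B)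
    (n1 _ hδ1 B) (fun t => by rw [hLF]; simp only [gb]; field_simp [cpt_ne B]) 1 0
  have E3 := edge_aux (fun t => L (t, 0)) (fun t => γ t / cpt C) (by fun_prop) (by fun_prop) (-cpt C)
    (n1 _ hγ1 C) (fun t => by rw [hLF]; simp only [dc]; field_simp [cpt_ne C]; ring) 1 0
  have E4 := edge_aux (fun t => L (t, 1)) (fun t => γ t / cpt D) (by fun_prop) (by fun_prop) (-cpt D)
    (n1 _ hγ1 D) (fun t => by rw [hLF]; simp only [dd]; field_simp [cpt_ne D]; ring) 1 0
  simp only [ga, gb, dc, dd, cpt_div] at E1 E2 E3 E4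
  replace E1 := congrArg Complex.im E1
  replace E2 := congrArg Complex.im E2
  replace E3 := congrArg Complex.im E3
  replace E4 := congrArg Complex.im E4
  have hpi := Real.pi_pos
  rw [Complex.sub_im, Complex.sub_im, log_im_pos _ (by linarith) (by linarith),
    log_im_pos _ (by linarith) (by linarith)] at E1
  rw [Complex.sub_im, Complex.sub_im, log_im_pos _ (by linarith) (by linarith),
    log_im_neg _ (by linarith) (by linarith)] at E2
  rw [Complex.sub_im, Complex.sub_im, log_im_pos _ (by linarith) (by linarith),
    log_im_neg _ (by linarith) (by linarith)] at E3
  rw [Complex.sub_im, Complex.sub_im, log_im_neg _ (by linarith) (by linarith),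
    log_im_neg _ (by linarith) (by linarith)] at E4
  linarith

theorem ext_path (G : ℝ → ℂ) (hG : Continuous G) (a b : ℂ) (ha : Tendsto G atBot (𝓝 a))
    (hb : Tendsto G atTop (𝓝 b)) : ∃ p : ℝ → ℂ,
    ContinuousOn p (Icc (-(Real.pi / 2)) (Real.pi / 2)) ∧ p (-(Real.pi / 2)) = a ∧
    p (Real.pi / 2) = b ∧ ∀ x ∈ Ioo (-(Real.pi / 2)) (Real.pi / 2), p x = G (Real.tan x) := by
  have hlt : -(Real.pi / 2) < Real.pi / 2 := by linarith [Real.pi_pos]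
  have hc : ContinuousOn (fun x => G (Real.tan x)) (Ioo (-(Real.pi / 2)) (Real.pi / 2)) :=
    hG.comp_continuousOn Real.continuousOn_tan_Ioo
  have h1 := ha.comp Real.tendsto_tan_neg_pi_div_two
  have h2 := hb.comp Real.tendsto_tan_pi_div_two
  refine ⟨extendFrom (Ioo (-(Real.pi / 2)) (Real.pi / 2)) (fun x => G (Real.tan x)),
    continuousOn_Icc_extendFrom_Ioo hc h1 h2, eq_lim_at_left_extendFrom_Ioo hlt h1,
    eq_lim_at_right_extendFrom_Ioo hlt h2, ?_⟩
  intro x hx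
  exact extendFrom_eq (subset_closure hx) (hc x hx)

theorem joined_of_path (p : ℝ → ℂ) (u v : ℝ) (huv : u ≤ v) (hp : ContinuousOn p (Icc u v))
    (V : Set ℂ) (h : ∀ x ∈ Icc u v, p x ∈ V) : JoinedIn V (p u) (p v) := by
  have h1 : IsPathConnected (Icc u v) := (convex_Icc u v).isPathConnected ⟨u, le_rfl, huv⟩
  exact ((h1.image' hp).joinedIn _ ⟨u, ⟨le_rfl, huv⟩, rfl⟩ _ ⟨v, ⟨huv, le_rfl⟩, rfl⟩).mono
    (by rintro _ ⟨x, hx, rfl⟩; exact h x hx)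

theorem joined_init (G : ℝ → ℂ) (hG : Continuous G) (a b : ℂ) (ha : Tendsto G atBot (𝓝 a))
    (hb : Tendsto G atTop (𝓝 b)) (V : Set ℂ) (haV : a ∈ V) (s : ℝ) (h : ∀ t ≤ s, G t ∈ V) :
    JoinedIn V a (G s) := by
  obtain ⟨p, hp, pa, pb, hpx⟩ := ext_path G hG a b ha hb
  have m1 := Real.neg_pi_div_two_lt_arctan s
  have m2 := Real.arctan_lt_pi_div_two s
  have := joined_of_path p (-(Real.pi / 2)) (Real.arctan s) m1.le
    (hp.mono (Icc_subset_Icc le_rfl m2.le)) V (by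
      intro x hx
      rcases eq_or_lt_of_le hx.1 with h1 | h1
      · rw [← h1, pa]; exact haV
      · rw [hpx x ⟨h1, hx.2.trans_lt m2⟩]
        apply h
        rw [← Real.tan_arctan s]
        exact Real.strictMonoOn_tan.monotoneOn ⟨h1, hx.2.trans_lt m2⟩ ⟨m1, m2⟩ hx.2)
  rwa [pa, hpx _ ⟨m1, m2⟩, Real.tan_arctan] at this

theorem joined_all (G : ℝ → ℂ) (hG : Continuous G) (a b : ℂ) (ha : Tendsto G atBot (𝓝 a))
    (hb : Tendsto G atTop (𝓝 b)) (V : Set ℂ) (haV : a ∈ V) (hbV : b ∈ V) (h : ∀ t, G t ∈ V) :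
    JoinedIn V a b := by
  obtain ⟨p, hp, pa, pb, hpx⟩ := ext_path G hG a b ha hb
  have := joined_of_path p (-(Real.pi / 2)) (Real.pi / 2) (by linarith [Real.pi_pos]) hp V (by
      intro x hx
      rcases eq_or_lt_of_le hx.1 with h1 | h1
      · rw [← h1, pa]; exact haV
      rcases eq_or_lt_of_le hx.2 with h2 | h2
      · rw [h2, pb]; exact hbV
      · rw [hpx x ⟨h1, h2⟩]; exact h _)
  rwa [pa, pb] at this

/-- The closed disk minus a curve with its end points. -/
def curveCompl (G : ℝ → ℂ) (a b : ℂ) : Set ℂ := {z | ‖z‖ ≤ 1 ∧ z ≠ a ∧ z ≠ b ∧ ∀ t, z ≠ G t}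

theorem not_joined (G : ℝ → ℂ) (hG : Continuous G) (hG1 : ∀ t, ‖G t‖ ≤ 1) (A C B D : ℝ)
    (hAC : A < C) (hCB : C < B) (hBD : B < D) (hDA : D < A + 2 * Real.pi)
    (ha : Tendsto G atBot (𝓝 (cpt A))) (hb : Tendsto G atTop (𝓝 (cpt B))) :
    ¬ JoinedIn (curveCompl G (cpt A) (cpt B)) (cpt C) (cpt D) := by
  rintro ⟨q, hq⟩
  obtain ⟨p, hp⟩ := joined_all G hG _ _ ha hb (range G ∪ {cpt A, cpt B}) (by simp) (by simp)
    (by simp)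
  have hpe : ∀ t, p.extend t ∈ range G ∪ {cpt A, cpt B} := fun t => hp _
  have hqe : ∀ t, q.extend t ∈ curveCompl G (cpt A) (cpt B) := fun t => hq _
  have hp1 : ∀ t, ‖p.extend t‖ ≤ 1 := by
    intro t
    rcases hpe t with ⟨s, hs⟩ | h | h
    · rw [← hs]; exact hG1 s
    · rw [h, cpt_norm]
    · rw [mem_singleton_iff.1 h, cpt_norm]
  obtain ⟨s, t, hst⟩ := crossing p.extend q.extend p.continuous_extend q.continuous_extend hp1
    (fun t => (hqe t).1) A C B D hAC hCB hBD hDA (by simp) (by simp) (by simp) (by simp)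
  obtain ⟨-, h1, h2, h3⟩ := hqe t
  rw [← hst] at h1 h2 h3
  rcases hpe s with ⟨u, hu⟩ | h | h
  · exact h3 u hu.symm
  · exact h1 h
  · exact h2 h

theorem cpt_shift (x : ℝ) (m : ℤ) : cpt (x + m * (2 * Real.pi)) = cpt x := by
  rw [cpt, cpt, Complex.exp_eq_exp_iff_exists_int]
  exact ⟨m, by push_cast; ring⟩

theorem cpt_eq {x y : ℝ} (h : cpt x = cpt y) : ∃ m : ℤ, x = y + m * (2 * Real.pi) := by
  rw [cpt, cpt, Complex.exp_eq_exp_iff_exists_int] at h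
  obtain ⟨m, hm⟩ := h
  refine ⟨m, ?_⟩
  have := congrArg Complex.im hm
  simpa using this

theorem cpt_rep {z : ℂ} (hz : z ∈ Metric.sphere (0 : ℂ) 1) (b : ℝ) :
    ∃ d, b ≤ d ∧ d < b + 2 * Real.pi ∧ z = cpt d := by
  have hpi : (0 : ℝ) < 2 * Real.pi := by linarith [Real.pi_pos]
  have hz1 : ‖z‖ = 1 := by simpa using hz
  have h1 : z = cpt z.arg := by
    have := Complex.norm_mul_exp_arg_mul_I z
    rw [hz1] at this
    simpa [cpt] using this.symm
  refine ⟨toIcoMod hpi b z.arg, left_le_toIcoMod _ _ _, toIcoMod_lt_right _ _ _, ?_⟩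
  rw [toIcoMod, h1]
  have := cpt_shift (cpt z.arg).arg (-(toIcoDiv hpi b (cpt z.arg).arg))
  rw [← h1] at this ⊢
  rw [zsmul_eq_mul, sub_eq_add_neg, ← neg_mul]
  rw [← Int.cast_neg, this, ← h1]

theorem arcI {a b c : ℝ} (h1 : a < b) (h2 : b < c) (h3 : c < a + 2 * Real.pi) :
    InCcwArc (cpt a) (cpt c) (cpt b) := ⟨a, b, c, h1, h2, h3, rfl, rfl, rfl⟩

theorem circle_order {n : ℕ} {Γ : ZMod n → ℝ → ↥Disk} {α ω : ZMod n → ℂ}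
    (hG : SettingG n Γ α ω) (k : ZMod n) : ∃ A C E B : ℝ, A < C ∧ C < E ∧ E < B ∧
      B < A + 2 * Real.pi ∧ α k = cpt A ∧ ω (k - 1) = cpt C ∧ α (k + 1) = cpt E ∧ ω k = cpt B ∧
      ∀ x ∈ Metric.sphere (0 : ℂ) 1, x ≠ ω (k - 1) → x ≠ ω k →
        ¬ InCcwArc (ω (k - 1)) (ω k) x → ¬ InCcwArc (ω (k - 1 - 1)) (ω (k - 1)) x →
        ∃ D, B < D ∧ D < A + 2 * Real.pi ∧ x = cpt D := by
  have hpi := Real.pi_pos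
  obtain ⟨a, b, c, hab, hbc, hca, ea, eb, ec⟩ := hG.arcMem k
  obtain ⟨a', b', c', hab', hbc', hca', ea', eb', ec'⟩ := hG.arcMem (k - 1)
  change _ = cpt _ at ea eb ec ea' eb' ec'
  rw [sub_add_cancel] at eb'
  obtain ⟨m, hm⟩ := cpt_eq (ec'.symm.trans ea)
  obtain ⟨A', hA'⟩ : ∃ A', A' = a' + (-m : ℤ) * (2 * Real.pi) := ⟨_, rfl⟩
  obtain ⟨A, hA⟩ : ∃ A, A = b' + (-m : ℤ) * (2 * Real.pi) := ⟨_, rfl⟩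
  rw [← cpt_shift _ (-m), ← hA'] at ea'
  rw [← cpt_shift _ (-m), ← hA] at eb'
  push_cast at hA hA'
  have h1 : A' < A := by linarith
  have h2 : A < a := by linarith
  have h3 : a < A' + 2 * Real.pi := by linarith
  have h4 : c - 2 * Real.pi ≤ A' := by
    by_contra! hcon
    apply hG.arcNoω (k - 1) k
    have := cpt_shift c (-1)
    rw [ea', ea, ec, ← this]
    apply arcI <;> push_cast <;> linarith
  refine ⟨A, a, b, c, h2, hab, hbc, by linarith, eb', ea, eb, ec, ?_⟩
  intro x hx n1 n2 n3 n4
  obtain ⟨d, hd1, hd2, hd⟩ := cpt_rep hx A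
  refine ⟨d, ?_, hd2, hd⟩
  by_contra! hcon
  rcases lt_trichotomy d a with h | h | h
  · apply n4
    rw [ea', ea, hd]
    exact arcI (by linarith) h h3
  · apply n1; rw [hd, h, ea]
  · rcases eq_or_lt_of_le hcon with h' | h'
    · apply n2; rw [hd, h', ec]
    · apply n3; rw [ea, ec, hd]; exact arcI h h' hca

/-- The order in which the curves are processed. -/
def cidx (n m : ℕ) : ZMod n := 1 - (m : ZMod n)

theorem cidx_ne {n l m : ℕ} (h : l < m) (hm : m < n) : cidx n l ≠ cidx n m := by
  intro he
  have h1 : (l : ZMod n) = (m : ZMod n) := by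
    simpa [cidx] using he
  rw [ZMod.natCast_eq_natCast_iff', Nat.mod_eq_of_lt (h.trans hm), Nat.mod_eq_of_lt hm] at h1
  omega

theorem cidx_sub (n m : ℕ) : cidx n m - 1 = cidx n (m + 1) := by
  simp only [cidx]; push_cast; ring

theorem cidx_zero (n : ℕ) : cidx n 0 = 1 := by simp [cidx]

theorem cidx_top (n : ℕ) : cidx n n = 1 := by simp [cidx]

/-- Curve number `m` is stopped on an earlier curve. -/
def Hits (n : ℕ) (Γ : ZMod n → ℝ → ↥Disk) (t : ℕ → ℝ) (m : ℕ) (s : ℝ) : Prop :=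
  ∃ l < m, ∃ u ≤ t l, Γ (cidx n m) s = Γ (cidx n l) u

theorem hit_exists {n : ℕ} {Γ : ZMod n → ℝ → ↥Disk} {α ω : ZMod n → ℂ}
    (hG : SettingG n Γ α ω) (t : ℕ → ℝ) (j : ℕ) (hj1 : 1 ≤ j) (hjn : j < n)
    (h0 : ∀ s, (∃ i', i' ≠ 1 ∧ Γ 1 s ∈ range (Γ i')) → s ≤ t 0)
    (hprev : ∀ m, 1 ≤ m → m < j → Hits n Γ t m (t m)) : ∃ s, Hits n Γ t j s := by
  by_contra! hno
  obtain ⟨k, hk⟩ : ∃ k, k = cidx n j := ⟨_, rfl⟩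
  have hk1 : k ≠ 1 := by rw [hk, ← cidx_zero n]; exact (cidx_ne hj1 hjn).symm
  have hlt1 : ∀ i s, ‖(Γ i s).1‖ < 1 := fun i s => mem_ball_zero_iff.1 (Γ i s).2
  have nα : ∀ i, ‖α i‖ = 1 := fun i => by simpa using hG.αmem i
  have nω : ∀ i, ‖ω i‖ = 1 := fun i => by simpa using hG.ωmem i
  have cc : ∀ i, Continuous fun t => (Γ i t).1 := fun i => continuous_subtype_val.comp (hG.cont i)
  obtain ⟨V, hV⟩ : ∃ V, V = curveCompl (fun t => (Γ k t).1) (α k) (ω k) := ⟨_, rfl⟩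
  have αV : ∀ i, i ≠ k → α i ∈ V := by
    intro i hi
    rw [hV]
    refine ⟨(nα i).le, fun h => hi (hG.αinj h), hG.αω i k, fun t h => ?_⟩
    have := hlt1 k t
    simp only at h
    rw [← h, nα] at this
    exact lt_irrefl _ this
  have ωV : ∀ i, i ≠ k → ω i ∈ V := by
    intro i hi
    rw [hV]
    refine ⟨(nω i).le, (hG.αω k i).symm, fun h => hi (hG.ωinj h), fun t h => ?_⟩
    have := hlt1 k t
    simp only at h
    rw [← h, nω] at this
    exact lt_irrefl _ this
  have ΓV : ∀ i s, (∀ u, Γ i s ≠ Γ k u) → (Γ i s).1 ∈ V := by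
    intro i s h
    rw [hV]
    refine ⟨(hlt1 i s).le, fun h => ?_, fun h => ?_, fun u hu => h u (Subtype.ext hu)⟩
    · have := hlt1 i s
      rw [h, nα] at this
      exact lt_irrefl _ this
    · have := hlt1 i s
      rw [h, nω] at this
      exact lt_irrefl _ this
  have GV : ∀ l < j, ∀ u ≤ t l, (Γ (cidx n l) u).1 ∈ V := by
    intro l hl u hu
    apply ΓV
    intro s hs
    exact hno s ⟨l, hl, u, hu, by rw [← hk, hs]⟩
  have G1V : ∀ u, (Γ 1 u).1 ∈ V := by
    intro u
    apply ΓV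
    intro s hs
    refine hno s ⟨0, hj1, u, h0 u ⟨k, hk1, s, hs.symm⟩, ?_⟩
    rw [← hk, cidx_zero, hs]
  have J1 : JoinedIn V (α 1) (ω 1) :=
    joined_all _ (cc 1) _ _ (hG.limBot 1) (hG.limTop 1) V (αV 1 hk1.symm) (ωV 1 hk1.symm) G1V
  have J0 : ∀ l < j, ∀ u ≤ t l, JoinedIn V (α (cidx n l)) (Γ (cidx n l) u).1 := by
    intro l hl u hu
    refine joined_init _ (cc _) _ _ (hG.limBot _) (hG.limTop _) V (αV _ ?_) u
      (fun v hv => GV l hl v (hv.trans hu))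
    rw [hk]; exact cidx_ne hl hjn
  have J : ∀ m < j, JoinedIn V (α (cidx n m)) (ω 1) := by
    intro m
    induction m using Nat.strong_induction_on with
    | _ m ih =>
      intro hm
      rcases Nat.eq_zero_or_pos m with h | h
      · rw [h, cidx_zero]; exact J1
      · obtain ⟨l, hl, u, hu, he⟩ := hprev m h hm
        have e1 := J0 m hm (t m) le_rfl
        rw [he] at e1
        exact (e1.trans (J0 l (hl.trans hm) u hu).symm).trans (ih l hl (hl.trans hm))
  have JJ := J (j - 1) (by omega)
  have hkj : cidx n (j - 1) = k + 1 := by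
    have := cidx_sub n (j - 1)
    rw [Nat.sub_add_cancel hj1, ← hk] at this
    rw [← this]; ring
  rw [hkj] at JJ
  obtain ⟨A, C, E, B, hAC, hCE, hEB, hBA, eA, eC, eE, eB, hD⟩ := circle_order hG k
  have lA := hG.limBot k
  have lB := hG.limTop k
  rw [eA] at lA
  rw [eB] at lB
  rw [eA, eB] at hV
  by_cases hk2 : k - 1 = 1
  · obtain ⟨D, hBD, hDA, eD⟩ := hD (α 1) (hG.αmem 1) (hG.αω _ _) (hG.αω _ _)
      (fun h => by
        have h1 := hG.arcOnlyα _ _ h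
        have h2 : (2 : ZMod n) = 0 := by linear_combination -hk2 - h1
        have h3 : ((2 : ℕ) : ZMod n) = 0 := by exact_mod_cast h2
        rw [ZMod.natCast_eq_zero_iff] at h3
        have := Nat.le_of_dvd (by norm_num) h3
        have := hG.hn
        omega)
      (fun h => by
        have h1 := hG.arcOnlyα _ _ h
        apply hk1
        rw [h1]; ring)
    rw [hk2] at eC
    rw [eC, eD, hV] at J1
    exact not_joined _ (cc k) (fun t => (hlt1 k t).le) A C B D hAC (hCE.trans hEB) hBD hDA lA lB
      J1.symm
  · obtain ⟨D, hBD, hDA, eD⟩ := hD (ω 1) (hG.ωmem 1) (fun h => hk2 (hG.ωinj h).symm)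
      (fun h => hk1 (hG.ωinj h).symm) (hG.arcNoω _ _) (hG.arcNoω _ _)
    rw [eE, eD, hV] at JJ
    exact not_joined _ (cc k) (fun t => (hlt1 k t).le) A E B D (hAC.trans hCE) hEB hBD hDA lA lB JJ

theorem fin_times {n : ℕ} {Γ : ZMod n → ℝ → ↥Disk} {α ω : ZMod n → ℂ}
    (hG : SettingG n Γ α ω) (i : ZMod n) :
    {s | ∃ i', i' ≠ i ∧ Γ i s ∈ range (Γ i')}.Finite := by
  have : NeZero n := ⟨by have := hG.hn; omega⟩
  have h : ∀ i', i' ≠ i → {s | Γ i s ∈ range (Γ i')}.Finite := by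
    intro i' hi
    have e : {s | Γ i s ∈ range (Γ i')} = Γ i ⁻¹' (range (Γ i) ∩ range (Γ i')) := by
      ext s; simp
    rw [e]
    refine Set.Finite.preimage ?_ (hG.finInter i i' hi.symm)
    intro s hs s' _ hss
    exact hG.noDouble i i' hi.symm _ hs s s' rfl hss.symm
  refine (Set.finite_iUnion (f := fun i' : {i' // i' ≠ i} => {s | Γ i s ∈ range (Γ i')})
    (fun i' => h i'.1 i'.2)).subset ?_
  rintro s ⟨i', hi, hs⟩
  exact mem_iUnion.2 ⟨⟨i', hi⟩, hs⟩

theorem times_exist {n : ℕ} {Γ : ZMod n → ℝ → ↥Disk} {α ω : ZMod n → ℂ}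
    (hG : SettingG n Γ α ω) (M : ℕ) (hM : M < n) : ∃ t : ℕ → ℝ,
    (∀ s, (∃ i', i' ≠ 1 ∧ Γ 1 s ∈ range (Γ i')) → s ≤ t 0) ∧
    ∀ m, 1 ≤ m → m ≤ M → Hits n Γ t m (t m) ∧ ∀ s, s < t m → ¬ Hits n Γ t m s := by
  induction M with
  | zero =>
    obtain ⟨b, hb⟩ := (fin_times hG 1).bddAbove
    exact ⟨fun _ => b, fun s hs => hb hs, fun m h1 h2 => by omega⟩
  | succ M ih =>
    obtain ⟨t, h0, ht⟩ := ih (by omega)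
    obtain ⟨s₀, hs₀⟩ := hit_exists hG t (M + 1) (by omega) hM h0
      (fun m h1 h2 => (ht m h1 (by omega)).1)
    have hfin : {s | Hits n Γ t (M + 1) s}.Finite := by
      refine (fin_times hG (cidx n (M + 1))).subset ?_
      rintro s ⟨l, hl, u, hu, he⟩
      exact ⟨cidx n l, cidx_ne hl hM, u, he.symm⟩
    obtain ⟨s, hs, hmin⟩ := Set.exists_min_image _ id hfin ⟨s₀, hs₀⟩
    have hcong : ∀ m ≤ M + 1, ∀ v, Hits n Γ (Function.update t (M + 1) s) m v ↔ Hits n Γ t m v := by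
      intro m hm v
      refine exists_congr fun l => and_congr_right fun hl => ?_
      rw [Function.update_of_ne (by omega)]
    refine ⟨Function.update t (M + 1) s, ?_, ?_⟩
    · rw [Function.update_of_ne (by omega)]; exact h0
    · intro m h1 h2
      simp only [hcong m h2]
      rcases eq_or_lt_of_le h2 with h | h
      · subst h
        rw [Function.update_self]
        exact ⟨hs, fun v hv hh => absurd (hmin v hh) (not_le.2 hv)⟩
      · rw [Function.update_of_ne (by omega)]
        exact ht m h1 (by omega)
/-- Lemma 5.3. -/
theorem handel_lem_5_3 (n : ℕ) (Γ : ZMod n → ℝ → ↥Disk) (α ω : ZMod n → ℂ)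
    (hG : SettingG n Γ α ω) :
    ∃ t : ZMod n → ℝ, CondA n Γ t ∧ n - 1 ≤ (SigmaSet n Γ t).ncard := by
  have hn := hG.hn
  have : NeZero n := ⟨by omega⟩
  obtain ⟨t, -, ht⟩ := times_exist hG (n - 1) (by omega)
  obtain ⟨r, hr⟩ : ∃ r : ZMod n → ℕ, r = fun i => (1 - i).val := ⟨_, rfl⟩
  have hrlt : ∀ i, r i < n := fun i => by rw [hr]; exact ZMod.val_lt _
  have hrc : ∀ i, cidx n (r i) = i := by
    intro i; rw [hr]; simp [cidx]
  have hcr : ∀ m < n, r (cidx n m) = m := by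
    intro m hm; rw [hr]; simp [cidx, ZMod.val_natCast, Nat.mod_eq_of_lt hm]
  have hdis : ∀ i j, r i < r j →
      Disjoint (Γ i '' Set.Iio (t (r i))) (Γ j '' Set.Iio (t (r j))) := by
    intro i j hij
    rw [Set.disjoint_left]
    rintro _ ⟨u, hu, rfl⟩ ⟨s, hs, he⟩
    refine (ht (r j) (by omega) (by have := hrlt j; omega)).2 s hs ⟨r i, hij, u, le_of_lt hu, ?_⟩
    rw [hrc, hrc, he]
  refine ⟨fun i => t (r i), ?_, ?_⟩
  · intro i j hij
    rcases lt_trichotomy (r i) (r j) with h | h | h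
    · exact hdis i j h
    · exact absurd (by rw [← hrc i, h, hrc j]) hij
    · exact (hdis j i h).symm
  · have key : ∃ x : ZMod n, ∀ i, i ≠ x → i ∈ SigmaSet n Γ (fun i => t (r i)) := by
      have mid : ∀ m, 1 ≤ m → m < n - 1 → cidx n m ∈ SigmaSet n Γ (fun i => t (r i)) := by
        intro m h1 h2
        obtain ⟨l, hl, u, hu, he⟩ := (ht m h1 (by omega)).1
        refine ⟨cidx n l, ?_, cidx_ne hl (by omega), Γ (cidx n m) (t m),
          ⟨t m, ?_, rfl⟩, ⟨u, ?_, he.symm⟩⟩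
        · rw [cidx_sub]; exact cidx_ne (by omega) (by omega)
        · simp [hcr m (by omega)]
        · simpa [hcr l (by omega)] using hu
      obtain ⟨l, hl, u, hu, he⟩ := (ht (n - 1) (by omega) le_rfl).1
      rcases Nat.eq_zero_or_pos l with h | h
      · subst h
        refine ⟨cidx n (n - 1), fun i hi => ?_⟩
        rcases Nat.eq_zero_or_pos (r i) with h | h
        · have e : i = cidx n 0 := by rw [← h, hrc]
          rw [e]
          refine ⟨cidx n (n - 1), ?_, (cidx_ne hl (by omega)).symm, Γ (cidx n (n - 1)) (t (n - 1)),
            ⟨u, ?_, he.symm⟩, ⟨t (n - 1), ?_, rfl⟩⟩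
          · rw [cidx_sub]; exact (cidx_ne (by omega) (by omega)).symm
          · simpa [hcr 0 (by omega)] using hu
          · simp [hcr (n - 1) (by omega)]
        · rw [← hrc i]
          refine mid _ h ?_
          have h1 := hrlt i
          have h2 : r i ≠ n - 1 := fun h => hi (by rw [← h, hrc])
          omega
      · refine ⟨cidx n 0, fun i hi => ?_⟩
        have h1 := hrlt i
        have h2 : r i ≠ 0 := fun h => hi (by rw [← h, hrc])
        rcases eq_or_ne (r i) (n - 1) with h3 | h3
        · have e : i = cidx n (n - 1) := by rw [← h3, hrc]
          rw [e]
          refine ⟨cidx n l, ?_, cidx_ne hl (by omega), Γ (cidx n (n - 1)) (t (n - 1)),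
            ⟨t (n - 1), ?_, rfl⟩, ⟨u, ?_, he.symm⟩⟩
          · rw [cidx_sub, Nat.sub_add_cancel (by omega), cidx_top, ← cidx_zero n]
            exact (cidx_ne h (by omega)).symm
          · simp [hcr (n - 1) (by omega)]
          · simpa [hcr l (by omega)] using hu
        · rw [← hrc i]
          exact mid _ (by omega) (by omega)
    obtain ⟨x, hx⟩ := key
    have h1 : ({x}ᶜ : Set (ZMod n)) ⊆ SigmaSet n Γ (fun i => t (r i)) := fun i hi => hx i hi
    have h2 := Set.ncard_le_ncard h1 (Set.toFinite _)
    rwa [Set.ncard_compl, Set.ncard_singleton, Nat.card_zmod] at h2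
end
end
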